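/- arXiv:1007.3808 — 10 statements merged into one kernel-verified Lean document; each statement's English description precedes it below -/
import Mathlib

section
/- Let H be an m×n parity-check matrix over the field F_3 with 3 elements, and let F be a 2×n matrix with nonnegative integer entries. Then the following two conditions are equivalent: (1) for every row index j ∈ {1,…,m}, the matrix F is realizable over the single parity-check code C_j (equivalently, F is an unscaled graph-cover pseudocodeword matrix of the code defined by H); (2) F belongs to the ternary fundamental cone K_3(H) and, regarding H as an integer matrix with entries in {0,1,2}, H·(F_1^T + 2·F_2^T) ≡ 0 (mod 3) componentwise, where F_1 and F_2 are the first and second rows of F. -/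
open Finset

/-- Entry `f_i^(α)` of a 2×n matrix `F` whose rows are indexed by the nonzero
elements `1, 2` of `F_3` (row `0` of `F` is the row for `α = 1`,
row `1` of `F` is the row for `α = 2`). Only used with `α ≠ 0`. -/
def entryR {n : ℕ} (F : Matrix (Fin 2) (Fin n) ℝ) (α : ZMod 3) (i : Fin n) : ℝ :=
  if α = 1 then F 0 i else F 1 i

/-- The support `I_j` of the `j`-th row of `H`. -/
def suppRow {m n : ℕ} (H : Matrix (Fin m) (Fin n) (ZMod 3)) (j : Fin m) : Finset (Fin n) :=
  Finset.univ.filter fun i => H j i ≠ 0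

/-- The ternary fundamental cone `K_3(H)`. -/
def ternaryCone {m n : ℕ} (H : Matrix (Fin m) (Fin n) (ZMod 3)) :
    Set (Matrix (Fin 2) (Fin n) ℝ) :=
  { F |
    (∀ j : Fin m, ∀ ℓ ∈ suppRow H j,
      2 * entryR F (H j ℓ) ℓ + entryR F (2 * H j ℓ) ℓ ≤
        2 * ∑ i ∈ (suppRow H j).erase ℓ, entryR F (2 * H j i) i
          + ∑ i ∈ (suppRow H j).erase ℓ, entryR F (H j i) i) ∧
    (∀ j : Fin m, ∀ ℓ ∈ suppRow H j,
      2 * entryR F (2 * H j ℓ) ℓ + entryR F (H j ℓ) ℓ ≤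
        2 * ∑ i ∈ (suppRow H j).erase ℓ, entryR F (H j i) i
          + ∑ i ∈ (suppRow H j).erase ℓ, entryR F (2 * H j i) i) ∧
    (∀ j : Fin m, ∀ k ∈ suppRow H j, ∀ ℓ ∈ suppRow H j, k ≠ ℓ →
      entryR F (H j k) k + entryR F (H j ℓ) ℓ ≤
        2 * ∑ i ∈ ((suppRow H j).erase k).erase ℓ, entryR F (H j i) i
          + ∑ i ∈ suppRow H j, entryR F (2 * H j i) i) ∧
    (∀ j : Fin m, ∀ k ∈ suppRow H j, ∀ ℓ ∈ suppRow H j, k ≠ ℓ →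
      entryR F (2 * H j k) k + entryR F (2 * H j ℓ) ℓ ≤
        2 * ∑ i ∈ ((suppRow H j).erase k).erase ℓ, entryR F (2 * H j i) i
          + ∑ i ∈ suppRow H j, entryR F (H j i) i) ∧
    (∀ α i, 0 ≤ F α i) }

/-- `H·(F_1^T + 2 F_2^T) ≡ 0 (mod 3)` componentwise, `H` regarded as an
integer matrix with entries in `{0,1,2}`. -/
def mod3Cond {m n : ℕ} (H : Matrix (Fin m) (Fin n) (ZMod 3))
    (F : Matrix (Fin 2) (Fin n) ℕ) : Prop :=
  ∀ j : Fin m, (∑ i, ((H j i).val : ℤ) * ((F 0 i : ℤ) + 2 * (F 1 i : ℤ))) % 3 = 0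

/-- `F` is realizable over the single parity-check code `C_j` determined by the
row `Hj`: its entries count occurrences of the symbols `1` and `2` in the
coordinates of a list of `M` codewords. -/
def Realizable3 {n : ℕ} (Hj : Fin n → ZMod 3) (F : Matrix (Fin 2) (Fin n) ℕ) : Prop :=
  ∃ (M : ℕ) (c : Fin M → Fin n → ZMod 3),
    (∀ μ, ∑ i, c μ i * Hj i = 0) ∧
    (∀ i, F 0 i = (Finset.univ.filter fun μ => c μ i = 1).card) ∧
    (∀ i, F 1 i = (Finset.univ.filter fun μ => c μ i = 2).card)

/-- Intermediate values of sums of natural-valued functions between `lo` and `hi`. -/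
theorem exists_sum_eq_of_le_of_le {ι : Type*} [Fintype ι] [DecidableEq ι] {lo hi : ι → ℕ}
    (h : ∀ i, lo i ≤ hi i) {N : ℕ} (hlo : ∑ i, lo i ≤ N) (hhi : N ≤ ∑ i, hi i) :
    ∃ x : ι → ℕ, (∀ i, lo i ≤ x i) ∧ (∀ i, x i ≤ hi i) ∧ ∑ i, x i = N := by
  induction N, hlo using Nat.le_induction with
  | base => exact ⟨lo, fun _ => le_rfl, h, rfl⟩
  | succ N _ ih =>
    obtain ⟨x, hx₁, hx₂, hx⟩ := ih (by omega)
    obtain ⟨i, -, hi'⟩ := exists_lt_of_sum_lt (s := univ) (f := x) (g := hi) (by omega)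
    refine ⟨x + Pi.single i 1, fun j => ?_, fun j => ?_, ?_⟩
    · have := hx₁ j
      simp only [Pi.add_apply]
      omega
    · rcases eq_or_ne j i with rfl | hj
      · simpa using hi'
      · simpa [hj] using hx₂ j
    · simp [sum_add_distrib, hx]

theorem exists_ne_pos_of_lt_sum {ι : Type*} [Fintype ι] [DecidableEq ι] {a : ι → ℕ} {i : ι}
    (h : a i < ∑ k, a k) : ∃ j, j ≠ i ∧ 0 < a j := by
  by_contra! hc
  have : ∑ k, a k = a i := sum_eq_single i (fun j _ hj => by have := hc j hj; omega) (by simp)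
  omega

theorem add_add_le_sum {ι : Type*} [Fintype ι] [DecidableEq ι] (t : ι → ℕ) {i j k : ι}
    (hij : i ≠ j) (hik : i ≠ k) (hjk : j ≠ k) : t i + t j + t k ≤ ∑ l, t l := by
  have := sum_le_sum_of_subset (f := t) (subset_univ {i, j, k})
  rw [sum_insert (by simp [hij, hik]), sum_pair hjk] at this
  omega

/-- The pair of `0/1`-vectors marking the positions of the symbols `1` and `2` in a word. -/
def symbolIndicators {ι : Type*} (v : ι → ZMod 3) : (ι → ℕ) × (ι → ℕ) :=
  (fun i => if v i = 1 then 1 else 0, fun i => if v i = 2 then 1 else 0)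

section Decomposition

variable {ι : Type*} [Fintype ι] [DecidableEq ι] {S : AddSubmonoid ((ι → ℕ) × (ι → ℕ))}

/-- Symbol counts with equally many `1`s and `2`s split into pairs `{1, 2}` on distinct
positions. -/
theorem mem_of_sum_eq_of_add_le (hS : ∀ v : ι → ZMod 3, ∑ i, v i = 0 → symbolIndicators v ∈ S)
    (N : ℕ) (a b : ι → ℕ) (ha : ∑ i, a i = N) (hb : ∑ i, b i = N)
    (hab : ∀ i, a i + b i ≤ N) : (a, b) ∈ S := by
  induction N generalizing a b with
  | zero =>
    have ha' : a = 0 := funext fun i => by have := hab i; simp; omega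
    have hb' : b = 0 := funext fun i => by have := hab i; simp; omega
    subst ha' hb'
    exact S.zero_mem
  | succ N ih =>
    have key : ∃ i j, i ≠ j ∧ 0 < a i ∧ 0 < b j ∧
        ∀ k, k ≠ i → k ≠ j → a k + b k ≤ N := by
      have hne : (univ : Finset ι).Nonempty := by
        rw [nonempty_iff_ne_empty]
        intro h
        simp [h] at ha
      obtain ⟨l, -, hl⟩ := exists_max_image univ (fun i => a i + b i) hne
      have hsum : ∑ i, (a i + b i) = 2 * (N + 1) := by rw [sum_add_distrib]; omega
      have hlpos : 0 < a l + b l := by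
        by_contra! h0
        have : ∑ i, (a i + b i) = 0 :=
          sum_eq_zero fun i _ => by have := hl i (mem_univ i); omega
        omega
      have hrest : ∀ j, j ≠ l → 0 < a j + b j → ∀ k, k ≠ l → k ≠ j → a k + b k ≤ N := by
        intro j hj hjpos k hkl hkj
        have h₁ := add_add_le_sum (fun i => a i + b i) hkl hkj hj.symm
        have h₂ := hl k (mem_univ k)
        omega
      have hl' := hab l
      rcases Nat.eq_zero_or_pos (a l) with h0 | hpos
      · obtain ⟨j, hj, hjpos⟩ := exists_ne_pos_of_lt_sum (a := a) (i := l) (by omega)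
        exact ⟨j, l, hj, hjpos, by omega,
          fun k hkj hkl => hrest j hj (by omega) k hkl hkj⟩
      · obtain ⟨j, hj, hjpos⟩ := exists_ne_pos_of_lt_sum (a := b) (i := l) (by omega)
        exact ⟨l, j, hj.symm, hpos, hjpos, hrest j hj (by omega)⟩
    obtain ⟨i, j, hij, hi, hj, hk⟩ := key
    have ha' : a = (a - Pi.single i 1) + Pi.single i 1 := by
      funext k
      rcases eq_or_ne k i with rfl | h
      · simp; omega
      · simp [h]
    have hb' : b = (b - Pi.single j 1) + Pi.single j 1 := by
      funext k
      rcases eq_or_ne k j with rfl | h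
      · simp; omega
      · simp [h]
    have hmem : (Pi.single i 1, Pi.single j 1) ∈ S := by
      have h := hS (Pi.single i 1 + Pi.single j 2)
        (by simp [sum_add_distrib]; decide)
      convert h using 1
      ext k
      · rcases eq_or_ne k i with rfl | hki
        · simp [symbolIndicators, hij]
        · rcases eq_or_ne k j with rfl | hkj
          · simp [symbolIndicators, hki]; decide
          · simp [symbolIndicators, hki, hkj]
      · rcases eq_or_ne k i with rfl | hki
        · simp [symbolIndicators, hij]; decide
        · rcases eq_or_ne k j with rfl | hkj
          · simp [symbolIndicators, hki]
          · simp [symbolIndicators, hki, hkj]; decide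
    have hrec : (a - Pi.single i 1, b - Pi.single j 1) ∈ S := by
      apply ih
      · have := congrArg (fun f : ι → ℕ => ∑ k, f k) ha'
        simp only [Pi.add_apply, sum_add_distrib, sum_pi_single', mem_univ, if_true] at this
        omega
      · have := congrArg (fun f : ι → ℕ => ∑ k, f k) hb'
        simp only [Pi.add_apply, sum_add_distrib, sum_pi_single', mem_univ, if_true] at this
        omega
      · intro k
        have h₁ := hab k
        rcases eq_or_ne k i with rfl | hki
        · simp [hij]; omega
        · rcases eq_or_ne k j with rfl | hkj
          · simp [hki]; omega
          · simpa [hki, hkj] using hk k hki hkj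
    have := S.add_mem hrec hmem
    rwa [Prod.mk_add_mk, ← ha', ← hb'] at this

/-- Counts of `1`s with total `3 * d` and maximum at most `d` split into triples of `1`s on
distinct positions. -/
theorem mem_of_sum_eq_three_mul (hS : ∀ v : ι → ZMod 3, ∑ i, v i = 0 → symbolIndicators v ∈ S)
    (d : ℕ) (a : ι → ℕ) (ha : ∑ i, a i = 3 * d) (had : ∀ i, a i ≤ d) : (a, 0) ∈ S := by
  induction d generalizing a with
  | zero =>
    have ha' : a = 0 := funext fun i => by have := had i; simp; omega
    subst ha'
    exact S.zero_mem
  | succ d ih =>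
    have h₁ : #{i | a i = d + 1} ≤ 3 := by
      have h := card_nsmul_le_sum (univ.filter fun i => a i = d + 1) (fun i => a i) (d + 1)
        (fun i hi => (mem_filter.1 hi).2.ge)
      have h' := sum_le_sum_of_subset (f := fun i => a i) (subset_univ (univ.filter fun i => a i = d + 1))
      rw [smul_eq_mul] at h
      exact Nat.le_of_mul_le_mul_right (by omega : _ * (d + 1) ≤ 3 * (d + 1)) (by omega)
    have h₂ : 3 ≤ #{i | a i ≠ 0} := by
      have h := sum_le_card_nsmul (univ.filter fun i => a i ≠ 0) a (d + 1) (fun i _ => had i)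
      rw [sum_filter_ne_zero, ha, smul_eq_mul] at h
      exact Nat.le_of_mul_le_mul_right h (by omega)
    obtain ⟨T, hT₁, hT₂, hT⟩ := exists_subsuperset_card_eq
      (s := univ.filter fun i => a i = d + 1) (t := univ.filter fun i => a i ≠ 0)
      (fun i hi => by simp at hi ⊢; omega) h₁ h₂
    set e : ι → ℕ := fun i => if i ∈ T then 1 else 0 with he
    have hmem : (e, 0) ∈ S := by
      have h := hS (fun i => if i ∈ T then 1 else 0) (by simp [hT]; decide)
      convert h using 1
      ext i <;> by_cases hi : i ∈ T <;> simp [symbolIndicators, hi, he]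
      · decide
      · decide
    have ha' : a = (a - e) + e := by
      funext i
      by_cases hi : i ∈ T
      · have := hT₂ hi
        simp [he, hi] at this ⊢; omega
      · simp [he, hi]
    have hrec : (a - e, 0) ∈ S := by
      apply ih
      · have := congrArg (fun f : ι → ℕ => ∑ k, f k) ha'
        have he' : ∑ i, e i = 3 := by simp [he, hT]
        simp only [Pi.add_apply, sum_add_distrib] at this
        omega
      · intro i
        have := had i
        by_cases hi : i ∈ T
        · simp [he, hi]; omega
        · have hne : a i ≠ d + 1 := fun h => hi (hT₁ (by simp [h]))
          simp [he, hi]; omega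
    have := S.add_mem hrec hmem
    rwa [Prod.mk_add_mk, ← ha', add_zero] at this

theorem mem_of_sum_eq_add (hS : ∀ v : ι → ZMod 3, ∑ i, v i = 0 → symbolIndicators v ∈ S)
    {B d : ℕ} {a b : ι → ℕ} (ha : ∑ i, a i = B + 3 * d) (hb : ∑ i, b i = B)
    (hab : ∀ i, a i + b i ≤ B + d) (haa : ∀ k l, k ≠ l → a k + a l ≤ B + 2 * d) :
    (a, b) ∈ S := by
  have hbB : ∀ i, b i ≤ B := fun i => hb ▸ single_le_sum (fun _ _ => Nat.zero_le _) (mem_univ i)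
  have hlo : ∑ i, (a i + b i - B) ≤ 3 * d := by
    rw [← sum_filter_ne_zero]
    set s := univ.filter fun i => a i + b i - B ≠ 0 with hs
    rcases (by omega : #s = 0 ∨ #s = 1 ∨ 2 ≤ #s) with h | h | h
    · simp [card_eq_zero.1 h]
    · obtain ⟨k, hk⟩ := card_eq_one.1 h
      have := hab k
      rw [hk, sum_singleton]
      omega
    · have h₁ : ∑ i ∈ s, (a i + b i - B) + #s * B = ∑ i ∈ s, (a i + b i) := by
        rw [← smul_eq_mul, ← sum_const, ← sum_add_distrib]
        refine sum_congr rfl fun i hi => ?_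
        have := (mem_filter.1 hi).2
        omega
      have h₂ := sum_le_sum_of_subset (f := fun i => a i + b i) (subset_univ s)
      have h₃ : ∑ i, (a i + b i) = 2 * B + 3 * d := by rw [sum_add_distrib]; omega
      have h₄ := Nat.mul_le_mul_right B h
      omega
  have hhi : 3 * d ≤ ∑ i, min d (a i) := by
    set s := univ.filter fun i => d < a i with hs
    have h₁ : ∑ i ∈ s, min d (a i) = #s * d := by
      rw [← smul_eq_mul, ← sum_const]
      exact sum_congr rfl fun i hi => min_eq_left (mem_filter.1 hi).2.le
    have h₂ : ∑ i ∈ sᶜ, min d (a i) = ∑ i ∈ sᶜ, a i :=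
      sum_congr rfl fun i hi => min_eq_right (by simpa [hs] using hi)
    have h₃ := sum_add_sum_compl s a
    have h₄ := sum_add_sum_compl s (fun i => min d (a i))
    rcases (by omega : #s = 0 ∨ #s = 1 ∨ #s = 2 ∨ 3 ≤ #s) with h | h | h | h
    · rw [card_eq_zero.1 h, sum_empty] at h₃
      rw [card_eq_zero.1 h] at h₂ h₄
      simp only [sum_empty] at h₄
      omega
    · obtain ⟨k, hk⟩ := card_eq_one.1 h
      rw [h] at h₁
      have := hab k
      have h₅ : ∑ i ∈ s, a i = a k := by rw [hk, sum_singleton]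
      omega
    · obtain ⟨k, l, hkl, hk⟩ := card_eq_two.1 h
      rw [h] at h₁
      have := haa k l hkl
      have h₅ : ∑ i ∈ s, a i = a k + a l := by rw [hk, sum_pair hkl]
      omega
    · have h₅ := Nat.mul_le_mul_right d h
      omega
  obtain ⟨x, hx₁, hx₂, hx⟩ := exists_sum_eq_of_le_of_le (lo := fun i => a i + b i - B)
    (hi := fun i => min d (a i))
    (fun i => by have := hab i; have := hbB i; simp only [le_min_iff]; omega) hlo hhi
  have hxa : ∀ i, x i ≤ a i := fun i => (hx₂ i).trans (min_le_right _ _)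
  have hax : a = x + (a - x) := funext fun i => by have := hxa i; simp; omega
  have h₁ : (x, 0) ∈ S :=
    mem_of_sum_eq_three_mul hS d x hx fun i => (hx₂ i).trans (min_le_left _ _)
  have h₂ : (a - x, b) ∈ S := by
    refine mem_of_sum_eq_of_add_le hS B _ _ ?_ hb fun i => ?_
    · have := congrArg (fun f : ι → ℕ => ∑ k, f k) hax
      simp only [Pi.add_apply, sum_add_distrib] at this
      omega
    · have := hx₁ i
      have := hxa i
      have := hbB i
      simp only [Pi.sub_apply] at *
      omega
  have := S.add_mem h₁ h₂
  rwa [Prod.mk_add_mk, ← hax, zero_add] at this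

end Decomposition

/-- The fundamental-cone inequalities of one parity check, where `a i` and `b i` count the
occurrences of the products `1` and `2` with the check coefficient at position `i ∈ s`. -/
def SatisfiesCheck {ι : Type*} (s : Finset ι) (a b : ι → ℕ) : Prop :=
  (∀ l ∈ s, 3 * (a l + b l) ≤ ∑ i ∈ s, (a i + 2 * b i)) ∧
  (∀ k ∈ s, ∀ l ∈ s, k ≠ l → 3 * (b k + b l) ≤ ∑ i ∈ s, (a i + 2 * b i))

theorem mem_of_satisfiesCheck {ι : Type*} [Fintype ι] [DecidableEq ι]
    {S : AddSubmonoid ((ι → ℕ) × (ι → ℕ))}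
    (hS : ∀ v : ι → ZMod 3, ∑ i, v i = 0 → symbolIndicators v ∈ S) {a b : ι → ℕ}
    (hab : SatisfiesCheck univ a b) (hba : SatisfiesCheck univ b a)
    (h3 : 3 ∣ ∑ i, (a i + 2 * b i)) : (a, b) ∈ S := by
  wlog hle : ∑ i, b i ≤ ∑ i, a i generalizing S a b
  · have h3' : 3 ∣ ∑ i, (b i + 2 * a i) := by
      rw [sum_add_distrib, ← mul_sum] at h3 ⊢
      omega
    have := this (S := S.comap (AddMonoidHom.prod (AddMonoidHom.snd _ _) (AddMonoidHom.fst _ _)))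
      (a := b) (b := a) (fun v hv => ?_) hba hab h3' (by omega)
    · simpa using this
    · have h := hS (-v) (by simp [hv])
      have hneg : ∀ z : ZMod 3, (-z = 1 ↔ z = 2) ∧ (-z = 2 ↔ z = 1) := by decide
      simpa [symbolIndicators, hneg] using h
  simp only [SatisfiesCheck, sum_add_distrib, ← mul_sum, mem_univ, true_imp_iff] at hab hba h3
  obtain ⟨d, hd⟩ : ∃ d, ∑ i, a i = ∑ i, b i + 3 * d :=
    ⟨(∑ i, a i - ∑ i, b i) / 3, by omega⟩
  refine mem_of_sum_eq_add hS hd rfl (fun i => ?_) (fun k l hkl => ?_)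
  · have := hab.1 i
    omega
  · have := hba.2 k l hkl
    omega

section Realizability

variable {m n : ℕ}

/-- The matrices realizable over a single parity check form an additive monoid. -/
def realizableSubmonoid (h : Fin n → ZMod 3) : AddSubmonoid (Matrix (Fin 2) (Fin n) ℕ) where
  carrier := {F | Realizable3 h F}
  zero_mem' := ⟨0, fun _ => 0, fun _ => by simp, fun _ => by simp, fun _ => by simp⟩
  add_mem' := by
    rintro F G ⟨M, c, hc, hc₁, hc₂⟩ ⟨N, d, hd, hd₁, hd₂⟩
    refine ⟨M + N, Fin.append c d, fun μ => ?_, fun i => ?_, fun i => ?_⟩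
    · induction μ using Fin.addCases with
      | left μ => simpa using hc μ
      | right μ => simpa using hd μ
    · simp [hc₁, hd₁, card_filter, Fin.sum_univ_add, -sum_boole]
    · simp [hc₂, hd₂, card_filter, Fin.sum_univ_add, -sum_boole]

theorem mem_realizableSubmonoid {h : Fin n → ZMod 3} {F : Matrix (Fin 2) (Fin n) ℕ} :
    F ∈ realizableSubmonoid h ↔ Realizable3 h F := Iff.rfl

/-- The matrix of symbol counts of a single word. -/
def wordMatrix (v : Fin n → ZMod 3) : Matrix (Fin 2) (Fin n) ℕ :=
  Matrix.of ![fun i => if v i = 1 then 1 else 0, fun i => if v i = 2 then 1 else 0]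

theorem wordMatrix_mem {h v : Fin n → ZMod 3} (hv : ∑ i, v i * h i = 0) :
    wordMatrix v ∈ realizableSubmonoid h :=
  ⟨1, fun _ => v, fun _ => hv, fun i => by rw [card_filter]; simp [wordMatrix, -sum_boole],
    fun i => by rw [card_filter]; simp [wordMatrix, -sum_boole]⟩

/-- Natural-number version of `entryR`. -/
def symbolCount (F : Matrix (Fin 2) (Fin n) ℕ) (α : ZMod 3) (i : Fin n) : ℕ :=
  if α = 1 then F 0 i else F 1 i

theorem entryR_map (F : Matrix (Fin 2) (Fin n) ℕ) (α : ZMod 3) (i : Fin n) :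
    entryR (F.map fun x => (x : ℝ)) α i = (symbolCount F α i : ℝ) := by
  unfold entryR symbolCount
  split_ifs <;> rfl

theorem single_inequality_iff {s : Finset (Fin n)} (a b : Fin n → ℕ) {l : Fin n} (hl : l ∈ s) :
    2 * (a l : ℝ) + b l ≤ 2 * ∑ i ∈ s.erase l, (b i : ℝ) + ∑ i ∈ s.erase l, (a i : ℝ) ↔
      3 * (a l + b l) ≤ ∑ i ∈ s, (a i + 2 * b i) := by
  rw [← Nat.cast_le (α := ℝ), sum_erase_eq_sub hl, sum_erase_eq_sub hl]
  push_cast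
  rw [sum_add_distrib, ← mul_sum]
  constructor <;> intro h <;> linarith

theorem pair_inequality_iff {s : Finset (Fin n)} (a b : Fin n → ℕ) {k l : Fin n} (hk : k ∈ s)
    (hl : l ∈ s) (hkl : k ≠ l) :
    (b k : ℝ) + b l ≤ 2 * ∑ i ∈ (s.erase k).erase l, (b i : ℝ) + ∑ i ∈ s, (a i : ℝ) ↔
      3 * (b k + b l) ≤ ∑ i ∈ s, (a i + 2 * b i) := by
  rw [← Nat.cast_le (α := ℝ), sum_erase_eq_sub (mem_erase.2 ⟨hkl.symm, hl⟩),
    sum_erase_eq_sub hk]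
  push_cast
  rw [sum_add_distrib, ← mul_sum]
  constructor <;> intro h <;> linarith

theorem map_mem_ternaryCone_iff (H : Matrix (Fin m) (Fin n) (ZMod 3))
    (F : Matrix (Fin 2) (Fin n) ℕ) :
    F.map (fun x => (x : ℝ)) ∈ ternaryCone H ↔ ∀ j,
      SatisfiesCheck (suppRow H j) (fun i => symbolCount F (H j i) i)
        (fun i => symbolCount F (2 * H j i) i) ∧
      SatisfiesCheck (suppRow H j) (fun i => symbolCount F (2 * H j i) i)
        (fun i => symbolCount F (H j i) i) := by
  simp only [ternaryCone, Set.mem_ofPred_eq, entryR_map]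
  have hs : ∀ j l (hl : l ∈ suppRow H j), _ := fun j l hl => single_inequality_iff
    (fun i => symbolCount F (H j i) i) (fun i => symbolCount F (2 * H j i) i) hl
  have hs' : ∀ j l (hl : l ∈ suppRow H j), _ := fun j l hl => single_inequality_iff
    (fun i => symbolCount F (2 * H j i) i) (fun i => symbolCount F (H j i) i) hl
  have hp : ∀ j k l (hk : k ∈ suppRow H j) (hl : l ∈ suppRow H j) (hkl : k ≠ l), _ :=
    fun j k l hk hl hkl => pair_inequality_iff
      (fun i => symbolCount F (H j i) i) (fun i => symbolCount F (2 * H j i) i) hk hl hkl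
  have hp' : ∀ j k l (hk : k ∈ suppRow H j) (hl : l ∈ suppRow H j) (hkl : k ≠ l), _ :=
    fun j k l hk hl hkl => pair_inequality_iff
      (fun i => symbolCount F (2 * H j i) i) (fun i => symbolCount F (H j i) i) hk hl hkl
  constructor
  · rintro ⟨h₁, h₂, h₃, h₄, -⟩ j
    exact ⟨⟨fun l hl => (hs j l hl).1 (h₁ j l hl),
      fun k hk l hl hkl => (hp j k l hk hl hkl).1 (h₄ j k hk l hl hkl)⟩,
      ⟨fun l hl => (hs' j l hl).1 (h₂ j l hl),
      fun k hk l hl hkl => (hp' j k l hk hl hkl).1 (h₃ j k hk l hl hkl)⟩⟩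
  · intro h
    exact ⟨fun j l hl => (hs j l hl).2 ((h j).1.1 l hl),
      fun j l hl => (hs' j l hl).2 ((h j).2.1 l hl),
      fun j k hk l hl hkl => (hp' j k l hk hl hkl).2 ((h j).2.2 k hk l hl hkl),
      fun j k hk l hl hkl => (hp j k l hk hl hkl).2 ((h j).1.2 k hk l hl hkl),
      fun α i => Nat.cast_nonneg _⟩

theorem mod3Cond_iff (H : Matrix (Fin m) (Fin n) (ZMod 3)) (F : Matrix (Fin 2) (Fin n) ℕ) :
    mod3Cond H F ↔ ∀ j, 3 ∣ ∑ i ∈ suppRow H j,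
      (symbolCount F (H j i) i + 2 * symbolCount F (2 * H j i) i) := by
  refine forall_congr' fun j => ?_
  rw [← Int.dvd_iff_emod_eq_zero, ← ZMod.natCast_eq_zero_iff,
    show (3 : ℤ) = ((3 : ℕ) : ℤ) from rfl, ← ZMod.intCast_zmod_eq_zero_iff_dvd, suppRow,
    sum_filter]
  push_cast
  refine iff_of_eq (congrArg (· = 0) (sum_congr rfl fun i _ => ?_))
  have hcases : ∀ z : ZMod 3, z = 0 ∨ z = 1 ∨ z = 2 := by decide
  have h4 : (2 * 2 : ZMod 3) = 1 := by decide
  have h21 : (2 : ZMod 3) ≠ 1 := by decide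
  have h20 : (2 : ZMod 3) ≠ 0 := by decide
  rcases hcases (H j i) with h | h | h
  · simp [h]
  · simp [h, symbolCount, h21]
  · simp [h, symbolCount, h4, h21, h20, mul_add, ← mul_assoc, add_comm]

theorem SatisfiesCheck.sum {ι κ : Type*} {s : Finset ι} {t : Finset κ} {a b : κ → ι → ℕ}
    (h : ∀ μ ∈ t, SatisfiesCheck s (a μ) (b μ)) :
    SatisfiesCheck s (fun i => ∑ μ ∈ t, a μ i) (fun i => ∑ μ ∈ t, b μ i) := by
  simp only [SatisfiesCheck, mul_sum, ← sum_add_distrib]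
  rw [sum_comm]
  refine ⟨fun l hl => sum_le_sum fun μ hμ => ?_,
    fun k hk l hl hkl => sum_le_sum fun μ hμ => ?_⟩
  · exact (h μ hμ).1 l hl
  · exact (h μ hμ).2 k hk l hl hkl

theorem indicator_add_two_mul_indicator (z : ZMod 3) :
    (if z = 1 then 1 else 0) + 2 * (if z = 2 then 1 else 0) = z.val := by
  revert z
  decide

theorem three_dvd_sum_val {ι : Type*} {s : Finset ι} {w : ι → ZMod 3}
    (hw : ∑ i ∈ s, w i = 0) : 3 ∣ ∑ i ∈ s, (w i).val := by
  rw [← ZMod.natCast_eq_zero_iff]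
  simpa using hw

theorem satisfiesCheck_of_sum_eq_zero {ι : Type*} {s : Finset ι} {w : ι → ZMod 3}
    (hw : ∑ i ∈ s, w i = 0) :
    SatisfiesCheck s (fun i => if w i = 1 then 1 else 0) (fun i => if w i = 2 then 1 else 0) := by
  classical
  simp only [SatisfiesCheck, indicator_add_two_mul_indicator]
  have h3 := three_dvd_sum_val hw
  have hval : ∀ z : ZMod 3, (if z = 1 then 1 else 0) + (if z = 2 then 1 else 0) ≤ z.val ∧
      (if z = 1 then 1 else 0) + (if z = 2 then 1 else 0) ≤ 1 ∧
      2 * (if z = 2 then 1 else 0) ≤ z.val ∧ (if z = 2 then 1 else 0) ≤ 1 := by decide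
  refine ⟨fun l hl => ?_, fun k hk l hl hkl => ?_⟩
  · have h₁ := single_le_sum (f := fun i => (w i).val) (fun _ _ => Nat.zero_le _) hl
    have h₂ := hval (w l)
    omega
  · have h₁ := sum_le_sum_of_subset (f := fun i => (w i).val)
      (insert_subset hk (singleton_subset_iff.2 hl))
    rw [sum_pair hkl] at h₁
    have h₂ := hval (w k)
    have h₃ := hval (w l)
    omega

theorem sum_suppRow (H : Matrix (Fin m) (Fin n) (ZMod 3)) (j : Fin m) (v : Fin n → ZMod 3) :
    ∑ i ∈ suppRow H j, v i * H j i = ∑ i, v i * H j i :=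
  sum_subset (subset_univ _) fun i _ hi => by
    have : H j i = 0 := by simpa [suppRow] using hi
    simp [this]

theorem SatisfiesCheck.congr {ι : Type*} {s : Finset ι} {a b a' b' : ι → ℕ}
    (h : SatisfiesCheck s a b) (ha : ∀ i ∈ s, a' i = a i) (hb : ∀ i ∈ s, b' i = b i) :
    SatisfiesCheck s a' b' := by
  have hsum : ∑ i ∈ s, (a' i + 2 * b' i) = ∑ i ∈ s, (a i + 2 * b i) :=
    sum_congr rfl fun i hi => by rw [ha i hi, hb i hi]
  refine ⟨fun l hl => ?_, fun k hk l hl hkl => ?_⟩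
  · rw [hsum, ha l hl, hb l hl]
    exact h.1 l hl
  · rw [hsum, hb k hk, hb l hl]
    exact h.2 k hk l hl hkl

theorem Realizable3.check {H : Matrix (Fin m) (Fin n) (ZMod 3)} {j : Fin m}
    {F : Matrix (Fin 2) (Fin n) ℕ} (hF : Realizable3 (H j) F) :
    SatisfiesCheck (suppRow H j) (fun i => symbolCount F (H j i) i)
        (fun i => symbolCount F (2 * H j i) i) ∧
      SatisfiesCheck (suppRow H j) (fun i => symbolCount F (2 * H j i) i)
        (fun i => symbolCount F (H j i) i) ∧
      3 ∣ ∑ i ∈ suppRow H j,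
        (symbolCount F (H j i) i + 2 * symbolCount F (2 * H j i) i) := by
  obtain ⟨M, c, hc, hc₁, hc₂⟩ := hF
  have hsum : ∀ μ, ∑ i ∈ suppRow H j, c μ i * H j i = 0 := fun μ =>
    (sum_suppRow H j (c μ)).trans (hc μ)
  have hcases : ∀ z : ZMod 3, z ≠ 0 → z = 1 ∨ z = 2 := by decide
  have hmul : ∀ z : ZMod 3, (z * 2 = 1 ↔ z = 2) ∧ (z * 2 = 2 ↔ z = 1) := by decide
  have h4 : (2 * 2 : ZMod 3) = 1 := by decide
  have h21 : (2 : ZMod 3) ≠ 1 := by decide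
  have hone : ∀ i ∈ suppRow H j, symbolCount F (H j i) i =
      ∑ μ, if c μ i * H j i = 1 then 1 else 0 := fun i hi => by
    rcases hcases (H j i) (by simpa [suppRow] using hi) with h | h <;>
      simp [h, symbolCount, hc₁, hc₂, card_filter, h21, hmul, -sum_boole]
  have htwo : ∀ i ∈ suppRow H j, symbolCount F (2 * H j i) i =
      ∑ μ, if c μ i * H j i = 2 then 1 else 0 := fun i hi => by
    rcases hcases (H j i) (by simpa [suppRow] using hi) with h | h <;>
      simp [h, symbolCount, hc₁, hc₂, card_filter, h21, h4, hmul, -sum_boole]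
  refine ⟨?_, ?_, ?_⟩
  · exact (SatisfiesCheck.sum fun μ _ => satisfiesCheck_of_sum_eq_zero (hsum μ)).congr hone htwo
  · have hneg : ∀ z : ZMod 3, (-z = 1 ↔ z = 2) ∧ (-z = 2 ↔ z = 1) := by decide
    have h := SatisfiesCheck.sum (t := univ) fun μ _ => satisfiesCheck_of_sum_eq_zero
      (w := fun i => -(c μ i * H j i)) (by rw [sum_neg_distrib, hsum μ, neg_zero])
    simp only [hneg] at h
    exact h.congr htwo hone
  · rw [sum_congr rfl fun i hi => by rw [hone i hi, htwo i hi]]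
    simp only [mul_sum, ← sum_add_distrib, indicator_add_two_mul_indicator]
    rw [sum_comm]
    exact dvd_sum fun μ _ => three_dvd_sum_val (hsum μ)

/-- The count matrix determined by the numbers of products `1` and `2` at the support of a
parity check, with zero columns outside the support. -/
def extendCounts (H : Matrix (Fin m) (Fin n) (ZMod 3)) (j : Fin m) :
    (suppRow H j → ℕ) × (suppRow H j → ℕ) →+ Matrix (Fin 2) (Fin n) ℕ where
  toFun p := Matrix.of ![fun i => if hi : i ∈ suppRow H j then
      if H j i = 1 then p.1 ⟨i, hi⟩ else p.2 ⟨i, hi⟩ else 0,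
    fun i => if hi : i ∈ suppRow H j then
      if H j i = 1 then p.2 ⟨i, hi⟩ else p.1 ⟨i, hi⟩ else 0]
  map_zero' := by
    ext α i
    fin_cases α <;> simp
  map_add' p q := by
    ext α i
    fin_cases α <;> simp <;> split_ifs <;> simp

theorem extendCounts_apply_zero (H : Matrix (Fin m) (Fin n) (ZMod 3)) (j : Fin m)
    (p : (suppRow H j → ℕ) × (suppRow H j → ℕ)) (i : Fin n) :
    extendCounts H j p 0 i = if hi : i ∈ suppRow H j then
      if H j i = 1 then p.1 ⟨i, hi⟩ else p.2 ⟨i, hi⟩ else 0 := rfl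

theorem extendCounts_apply_one (H : Matrix (Fin m) (Fin n) (ZMod 3)) (j : Fin m)
    (p : (suppRow H j → ℕ) × (suppRow H j → ℕ)) (i : Fin n) :
    extendCounts H j p 1 i = if hi : i ∈ suppRow H j then
      if H j i = 1 then p.2 ⟨i, hi⟩ else p.1 ⟨i, hi⟩ else 0 := rfl

theorem extendCounts_symbolIndicators_mem (H : Matrix (Fin m) (Fin n) (ZMod 3)) (j : Fin m)
    (v : suppRow H j → ZMod 3) (hv : ∑ i, v i = 0) :
    extendCounts H j (symbolIndicators v) ∈ realizableSubmonoid (H j) := by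
  have hcases : ∀ z : ZMod 3, z ≠ 0 → z = 1 ∨ z = 2 := by decide
  have hmul : ∀ z : ZMod 3, (z * 2 = 1 ↔ z = 2) ∧ (z * 2 = 2 ↔ z = 1) := by decide
  have h21 : (2 : ZMod 3) ≠ 1 := by decide
  set u : Fin n → ZMod 3 := fun i => if hi : i ∈ suppRow H j then v ⟨i, hi⟩ * H j i else 0 with hu
  have hsum : ∑ i, u i * H j i = 0 := by
    rw [← sum_suppRow, ← sum_coe_sort, ← hv]
    refine sum_congr rfl fun i _ => ?_
    have hi : H j i ≠ 0 := by simpa [suppRow] using i.2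
    have hsq : ∀ y z : ZMod 3, z ≠ 0 → y * z * z = y := by decide
    simpa [hu] using hsq (v i) (H j i) hi
  convert wordMatrix_mem hsum using 1
  ext α i
  by_cases hi : i ∈ suppRow H j
  · rcases hcases (H j i) (by simpa [suppRow] using hi) with h | h <;> fin_cases α <;>
      simp [extendCounts_apply_zero, extendCounts_apply_one, symbolIndicators, wordMatrix,
        hu, hi, h, hmul, h21]
  · have h02 : (0 : ZMod 3) ≠ 2 := by decide
    fin_cases α <;> simp [extendCounts_apply_zero, extendCounts_apply_one, wordMatrix, hu, hi, h02]

theorem eq_extendCounts_add (H : Matrix (Fin m) (Fin n) (ZMod 3)) (j : Fin m)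
    (F : Matrix (Fin 2) (Fin n) ℕ) :
    F = extendCounts H j (fun i => symbolCount F (H j i) i, fun i => symbolCount F (2 * H j i) i) +
      ∑ i ∈ (suppRow H j)ᶜ,
        (F 0 i • wordMatrix (Pi.single i 1) + F 1 i • wordMatrix (Pi.single i 2)) := by
  have hcases : ∀ z : ZMod 3, z ≠ 0 → z = 1 ∨ z = 2 := by decide
  have h4 : (2 * 2 : ZMod 3) = 1 := by decide
  have h21 : (2 : ZMod 3) ≠ 1 := by decide
  have h12 : (1 : ZMod 3) ≠ 2 := by decide
  have h02 : (0 : ZMod 3) ≠ 2 := by decide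
  ext α k
  rw [Matrix.add_apply, Matrix.sum_apply]
  by_cases hk : k ∈ suppRow H j
  · rw [sum_eq_zero fun i hi => ?_]
    · rcases hcases (H j k) (by simpa [suppRow] using hk) with h | h <;> fin_cases α <;>
        simp [extendCounts_apply_zero, extendCounts_apply_one, symbolCount, hk, h, h4, h21]
    · have hki : k ≠ i := fun h => (mem_compl.1 hi) (h ▸ hk)
      fin_cases α <;> simp [wordMatrix, hki, h02]
  · rw [sum_eq_single_of_mem k (mem_compl.2 hk) fun i _ hik => ?_]
    · fin_cases α <;> simp [extendCounts_apply_zero, extendCounts_apply_one, wordMatrix, hk, h21, h12]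
    · fin_cases α <;> simp [wordMatrix, hik.symm, h02]

theorem realizable3_of_check {H : Matrix (Fin m) (Fin n) (ZMod 3)} {j : Fin m}
    {F : Matrix (Fin 2) (Fin n) ℕ}
    (h₁ : SatisfiesCheck (suppRow H j) (fun i => symbolCount F (H j i) i)
      (fun i => symbolCount F (2 * H j i) i))
    (h₂ : SatisfiesCheck (suppRow H j) (fun i => symbolCount F (2 * H j i) i)
      (fun i => symbolCount F (H j i) i))
    (h3 : 3 ∣ ∑ i ∈ suppRow H j,
      (symbolCount F (H j i) i + 2 * symbolCount F (2 * H j i) i)) :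
    Realizable3 (H j) F := by
  have hcoe : ∀ {a b : Fin n → ℕ}, SatisfiesCheck (suppRow H j) a b →
      SatisfiesCheck (univ : Finset (suppRow H j)) (fun i => a i) (fun i => b i) := by
    intro a b h
    have hs := sum_coe_sort (suppRow H j) (fun i => a i + 2 * b i)
    refine ⟨fun l _ => ?_, fun k _ l _ hkl => ?_⟩
    · rw [hs]
      exact h.1 l l.2
    · rw [hs]
      exact h.2 k k.2 l l.2 fun h => hkl (Subtype.ext h)
  have hmem := mem_of_satisfiesCheck (S := (realizableSubmonoid (H j)).comap (extendCounts H j))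
    (extendCounts_symbolIndicators_mem H j) (hcoe h₁) (hcoe h₂)
    (by rwa [sum_coe_sort (suppRow H j)
      (fun i => symbolCount F (H j i) i + 2 * symbolCount F (2 * H j i) i)])
  rw [← mem_realizableSubmonoid, eq_extendCounts_add H j F]
  refine add_mem hmem (sum_mem fun i hi => ?_)
  have hi' : H j i = 0 := by simpa [suppRow] using hi
  have hz : ∀ z : ZMod 3, ∑ k, (Pi.single i z : Fin n → ZMod 3) k * H j k = 0 := fun z => by
    simp [Pi.single_apply, hi']
  exact add_mem (nsmul_mem (wordMatrix_mem (hz 1)) _) (nsmul_mem (wordMatrix_mem (hz 2)) _)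

end Realizability

/-- Theorem 4 (characterization of graph-cover pseudocodewords over `F_3`):
a nonnegative integer 2×n matrix `F` is an unscaled graph-cover pseudocodeword
matrix of the code with parity-check matrix `H` (equivalently, realizable over
every single parity-check code `C_j`) iff `F ∈ K_3(H)` and
`H·(F_1^T + 2 F_2^T) ≡ 0 (mod 3)`. -/
theorem ternary_pseudocodeword_characterization {m n : ℕ}
    (H : Matrix (Fin m) (Fin n) (ZMod 3)) (F : Matrix (Fin 2) (Fin n) ℕ) :
    (∀ j : Fin m, Realizable3 (H j) F) ↔
      (F.map (fun x => (x : ℝ)) ∈ ternaryCone H ∧ mod3Cond H F) := by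
  rw [map_mem_ternaryCone_iff, mod3Cond_iff, ← forall_and]
  refine forall_congr' fun j => ⟨fun h => ?_, fun h => realizable3_of_check h.1.1 h.1.2 h.2⟩
  exact ⟨⟨h.check.1, h.check.2.1⟩, h.check.2.2⟩
end

section
/- Let H be an m×n parity-check matrix over F_3 and let Z ∈ K_3(H) be a 2×n real matrix in the ternary fundamental cone. Then for every ε > 0 there exist a real number c > 0 and a 2×n nonnegative integer matrix F with F ∈ K_3(H) and H·(F_1^T + 2·F_2^T) ≡ 0 (mod 3) (H regarded as an integer matrix with entries in {0,1,2}; i.e., F is an unscaled graph-cover pseudocodeword matrix) such that ‖c·F − Z‖ < ε. -/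
open Finset

section

open Filter Topology

/-- There is a sequence of `ℚ`-linear maps `ℝ → ℚ` converging pointwise to the identity. -/
lemma exists_ratLinearMap_tendsto :
    ∃ φ : ℕ → ℝ →ₗ[ℚ] ℚ, ∀ x : ℝ, Tendsto (fun k => (φ k x : ℝ)) atTop (𝓝 x) := by
  let B := Module.Basis.ofVectorSpace ℚ ℝ
  have approx : ∀ x : ℝ, ∃ u : ℕ → ℚ, Tendsto (fun k => (u k : ℝ)) atTop (𝓝 x) := by
    intro x
    obtain ⟨u, -, -, hu⟩ := Real.exists_seq_rat_strictMono_tendsto x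
    exact ⟨u, hu⟩
  choose u hu using approx
  refine ⟨fun k => B.constr ℚ fun b => u (B b) k, fun x => ?_⟩
  have hsum : ∑ b ∈ (B.repr x).support, (B.repr x b : ℝ) * B b = x := by
    conv_rhs => rw [← B.linearCombination_repr x]
    simp [Finsupp.linearCombination_apply, Finsupp.sum, Rat.smul_def]
  have hlim : Tendsto (fun k => ∑ b ∈ (B.repr x).support, (B.repr x b : ℝ) * (u (B b) k : ℝ))
      atTop (𝓝 (∑ b ∈ (B.repr x).support, (B.repr x b : ℝ) * B b)) :=
    tendsto_finsetSum _ fun b _ => (hu (B b)).const_mul _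
  rw [hsum] at hlim
  refine hlim.congr fun k => ?_
  simp [Module.Basis.constr_apply, Finsupp.sum]

lemma entryR_map_s1 {n : ℕ} (Z : Matrix (Fin 2) (Fin n) ℝ) (f : ℝ → ℝ) (α : ZMod 3) (i : Fin n) :
    entryR (Z.map f) α i = f (entryR Z α i) := by
  unfold entryR
  split_ifs <;> rfl

/-- An additive map that eventually preserves each inequality eventually preserves membership in
the fundamental cone. -/
lemma eventually_map_mem_ternaryCone {m n : ℕ} {H : Matrix (Fin m) (Fin n) (ZMod 3)}
    {Z : Matrix (Fin 2) (Fin n) ℝ} (hZ : Z ∈ ternaryCone H) {ι : Type*} {l : Filter ι}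
    (L : ι → ℝ →+ ℝ) (hL : ∀ a b : ℝ, a ≤ b → ∀ᶠ k in l, L k a ≤ L k b) :
    ∀ᶠ k in l, Z.map (L k) ∈ ternaryCone H := by
  obtain ⟨h1, h2, h3, h4, h5⟩ := hZ
  simp only [ternaryCone, Set.mem_ofPred_eq, eventually_and, eventually_all, entryR_map_s1,
    Matrix.map_apply]
  refine ⟨fun j ℓ hℓ => ?_, fun j ℓ hℓ => ?_, fun j k hk ℓ hℓ hne => ?_,
    fun j k hk ℓ hℓ hne => ?_, fun α i => ?_⟩
  · filter_upwards [hL _ _ (h1 j ℓ hℓ)] with k hk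
    simpa only [two_mul, map_add, map_sum] using hk
  · filter_upwards [hL _ _ (h2 j ℓ hℓ)] with k hk
    simpa only [two_mul, map_add, map_sum] using hk
  · filter_upwards [hL _ _ (h3 j k hk ℓ hℓ hne)] with k hk
    simpa only [two_mul, map_add, map_sum] using hk
  · filter_upwards [hL _ _ (h4 j k hk ℓ hℓ hne)] with k hk
    simpa only [two_mul, map_add, map_sum] using hk
  · filter_upwards [hL _ _ (h5 α i)] with k hk
    simpa only [map_zero] using hk

lemma map_mul_mem_ternaryCone {m n : ℕ} {H : Matrix (Fin m) (Fin n) (ZMod 3)}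
    {Z : Matrix (Fin 2) (Fin n) ℝ} (hZ : Z ∈ ternaryCone H) {c : ℝ} (hc : 0 ≤ c) :
    Z.map (c * ·) ∈ ternaryCone H :=
  (eventually_map_mem_ternaryCone (l := (⊤ : Filter Unit)) hZ
    (fun _ => AddMonoidHom.mulLeft c)
    fun _ _ hab => Eventually.of_forall fun _ => mul_le_mul_of_nonneg_left hab hc).exists.choose_spec

/-- A matrix of nonnegative rationals has a positive integer multiple with entries in `ℕ`. -/
lemma exists_nat_matrix_eq_mul {m n : Type*} [Fintype m] [Fintype n] (q : Matrix m n ℚ)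
    (hq : ∀ i j, 0 ≤ q i j) :
    ∃ (d : ℕ) (F : Matrix m n ℕ), 0 < d ∧ ∀ i j, (F i j : ℚ) = d * q i j := by
  have hdvd : ∀ i j, (q i j).den ∣ ∏ p : m × n, (q p.1 p.2).den := fun i j =>
    Finset.dvd_prod_of_mem (fun p : m × n => (q p.1 p.2).den) (Finset.mem_univ (i, j))
  choose e he using hdvd
  refine ⟨∏ p : m × n, (q p.1 p.2).den, fun i j => (q i j).num.toNat * e i j,
    Finset.prod_pos fun p _ => (q p.1 p.2).pos, fun i j => ?_⟩
  have hnum : (((q i j).num.toNat : ℕ) : ℚ) = (q i j).num := by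
    exact_mod_cast Int.toNat_of_nonneg (Rat.num_nonneg.2 (hq i j))
  rw [he i j]
  push_cast
  rw [hnum, ← Rat.den_mul_eq_num]
  ring

lemma mod3Cond_three_mul {m n : ℕ} (H : Matrix (Fin m) (Fin n) (ZMod 3))
    (F : Matrix (Fin 2) (Fin n) ℕ) : mod3Cond H (F.map (3 * ·)) := by
  intro j
  refine Int.emod_eq_zero_of_dvd (Finset.dvd_sum fun i _ => Dvd.dvd.mul_left ?_ _)
  simp only [Matrix.map_apply]
  push_cast
  omega

end

/-- Theorem 9 (density of scaled pseudocodewords in the fundamental cone):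
for every `Z ∈ K_3(H)` and `ε > 0` there are `c > 0` and an unscaled
graph-cover pseudocodeword matrix `F` with `‖c·F − Z‖ < ε`
(Euclidean norm on 2×n real matrices). -/
theorem ternary_cone_density {m n : ℕ} (H : Matrix (Fin m) (Fin n) (ZMod 3))
    (Z : Matrix (Fin 2) (Fin n) ℝ) (hZ : Z ∈ ternaryCone H) :
    ∀ ε : ℝ, 0 < ε → ∃ (c : ℝ) (F : Matrix (Fin 2) (Fin n) ℕ),
      0 < c ∧
      F.map (fun x => (x : ℝ)) ∈ ternaryCone H ∧
      mod3Cond H F ∧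
      Real.sqrt (∑ α : Fin 2, ∑ i : Fin n, (c * (F α i : ℝ) - Z α i) ^ 2) < ε := by
  intro ε hε
  obtain ⟨φ, hφ⟩ := exists_ratLinearMap_tendsto
  have hmono : ∀ a b : ℝ, a ≤ b → ∀ᶠ k in Filter.atTop, (φ k a : ℝ) ≤ φ k b := by
    intro a b hab
    rcases hab.eq_or_lt with rfl | hlt
    · exact Filter.Eventually.of_forall fun _ => le_rfl
    · exact ((hφ a).eventually_lt (hφ b) hlt).mono fun _ h => h.le
  have hcone := eventually_map_mem_ternaryCone hZ
    (fun k => (Rat.castHom ℝ).toAddMonoidHom.comp (φ k).toAddMonoidHom) hmono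
  have hnorm : Filter.Tendsto
      (fun k => Real.sqrt (∑ α : Fin 2, ∑ i : Fin n, ((φ k (Z α i) : ℝ) - Z α i) ^ 2))
      Filter.atTop (nhds 0) := by
    have h := (tendsto_finsetSum Finset.univ fun (α : Fin 2) _ =>
      tendsto_finsetSum Finset.univ fun (i : Fin n) _ =>
        ((hφ (Z α i)).sub_const (Z α i)).pow 2).sqrt
    simpa using h
  obtain ⟨k, hk, hkε⟩ := (hcone.and (hnorm.eventually_lt_const hε)).exists
  obtain ⟨d, F, hd, hF⟩ := exists_nat_matrix_eq_mul (Z.map (φ k)) fun α i => by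
    have h : (0 : ℝ) ≤ φ k (Z α i) := hk.2.2.2.2 α i
    exact_mod_cast h
  have hFR : ∀ α i, (F α i : ℝ) = d * φ k (Z α i) := fun α i => by
    have h := hF α i
    rw [Matrix.map_apply] at h
    exact_mod_cast h
  have hd' : (0 : ℝ) < d := by exact_mod_cast hd
  refine ⟨(3 * d : ℝ)⁻¹, F.map (3 * ·), by positivity, ?_, mod3Cond_three_mul H F, ?_⟩
  · convert map_mul_mem_ternaryCone hk (c := 3 * d) (by positivity) using 1
    ext α i
    simp [hFR, mul_assoc]
  · have hentry : ∀ α i, (3 * d : ℝ)⁻¹ * ((F.map (3 * ·) α i : ℕ) : ℝ) = φ k (Z α i) :=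
      fun α i => by
        rw [Matrix.map_apply, Nat.cast_mul, hFR]
        push_cast
        field_simp
    simpa only [hentry] using hkε
end

section
/- Let H be an m×n parity-check matrix over the binary field F_2, and let F = (f_1,…,f_n) be a vector of nonnegative integers. Then the following two conditions are equivalent: (1) for every row index j ∈ {1,…,m}, there exist M ∈ ℕ and codewords c^(1),…,c^(M) ∈ C_j = {c ∈ F_2^n : c·H_j^T = 0} such that f_i = |{μ : c^(μ)_i = 1}| for all i (equivalently, F is an unscaled graph-cover pseudocodeword vector of the code defined by H); (2) F belongs to the binary fundamental cone K_2(H) and, regarding H as a 0/1 integer matrix, H·F^T ≡ 0 (mod 2) componentwise. -/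
open Finset

/-- The support `I_j` of the `j`-th row of a binary matrix `H`. -/
def suppRow2 {m n : ℕ} (H : Matrix (Fin m) (Fin n) (ZMod 2)) (j : Fin m) : Finset (Fin n) :=
  Finset.univ.filter fun i => H j i ≠ 0

/-- The binary fundamental cone `K_2(H)`. -/
def binaryCone {m n : ℕ} (H : Matrix (Fin m) (Fin n) (ZMod 2)) : Set (Fin n → ℝ) :=
  { f |
    (∀ j : Fin m, ∀ ℓ ∈ suppRow2 H j, f ℓ ≤ ∑ i ∈ (suppRow2 H j).erase ℓ, f i) ∧
    (∀ i, 0 ≤ f i) }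

/-- `H·F^T ≡ 0 (mod 2)` componentwise, `H` regarded as a 0/1 integer matrix. -/
def mod2Cond {m n : ℕ} (H : Matrix (Fin m) (Fin n) (ZMod 2)) (F : Fin n → ℕ) : Prop :=
  ∀ j : Fin m, (∑ i, ((H j i).val : ℤ) * (F i : ℤ)) % 2 = 0

/-- `F` is realizable over the single parity-check code `C_j` determined by the
row `Hj`: its entries count occurrences of the symbol `1` in the coordinates of
a list of `M` codewords. -/
def Realizable2 {n : ℕ} (Hj : Fin n → ZMod 2) (F : Fin n → ℕ) : Prop :=
  ∃ (M : ℕ) (c : Fin M → Fin n → ZMod 2),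
    (∀ μ, ∑ i, c μ i * Hj i = 0) ∧
    (∀ i, F i = (Finset.univ.filter fun μ => c μ i = 1).card)

theorem zmod_two_eq_one_of_ne_zero {x : ZMod 2} (hx : x ≠ 0) : x = 1 := by
  revert x
  decide

/-- The support of a single binary parity check. -/
def checkSupport {n : ℕ} (h : Fin n → ZMod 2) : Finset (Fin n) :=
  univ.filter fun i => h i ≠ 0

theorem eq_one_of_mem_checkSupport {n : ℕ} {h : Fin n → ZMod 2} {i : Fin n}
    (hi : i ∈ checkSupport h) : h i = 1 :=
  zmod_two_eq_one_of_ne_zero (mem_filter.mp hi).2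

theorem sum_mul_eq_sum_checkSupport {n : ℕ} (h c : Fin n → ZMod 2) :
    ∑ i, c i * h i = ∑ i ∈ checkSupport h, c i := by
  rw [checkSupport, sum_filter]
  refine sum_congr rfl fun i _ => ?_
  split_ifs with hi
  · rw [zmod_two_eq_one_of_ne_zero hi, mul_one]
  · rw [not_not.mp hi, mul_zero]

theorem natCast_card_filter_eq_one {ι : Type*} (s : Finset ι) (c : ι → ZMod 2) :
    ((s.filter fun i => c i = 1).card : ZMod 2) = ∑ i ∈ s, c i := by
  rw [card_filter, Nat.cast_sum]
  refine sum_congr rfl fun i _ => ?_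
  split_ifs with hi
  · simp [hi]
  · have : c i = 0 := by
      by_contra h0
      exact hi (zmod_two_eq_one_of_ne_zero h0)
    simp [this]

/-- The inequality and parity conditions imposed on `F` by a single check. -/
def CheckCond {n : ℕ} (h : Fin n → ZMod 2) (F : Fin n → ℕ) : Prop :=
  (∀ l ∈ checkSupport h, 2 * F l ≤ ∑ i ∈ checkSupport h, F i) ∧
    Even (∑ i ∈ checkSupport h, F i)

theorem Realizable2.checkCond {n : ℕ} {h : Fin n → ZMod 2} {F : Fin n → ℕ}
    (hF : Realizable2 h F) : CheckCond h F := by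
  obtain ⟨M, c, hc, hcount⟩ := hF
  have heven (μ : Fin M) : Even ((checkSupport h).filter fun i => c μ i = 1).card := by
    rw [← ZMod.natCast_eq_zero_iff_even, natCast_card_filter_eq_one,
      ← sum_mul_eq_sum_checkSupport, hc]
  have hsum : ∑ i ∈ checkSupport h, F i
      = ∑ μ, ((checkSupport h).filter fun i => c μ i = 1).card := by
    simp only [hcount, card_filter]
    exact sum_comm
  rw [CheckCond, hsum]
  refine ⟨fun l hl => ?_, even_sum _ fun μ _ => heven μ⟩
  rw [hcount, card_filter, mul_sum]
  refine sum_le_sum fun μ _ => ?_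
  split_ifs with hμ
  · have hpos : 0 < ((checkSupport h).filter fun i => c μ i = 1).card :=
      card_pos.mpr ⟨l, mem_filter.mpr ⟨hl, hμ⟩⟩
    obtain ⟨k, hk⟩ := heven μ
    omega
  · simp

theorem Realizable2.add {n : ℕ} {h : Fin n → ZMod 2} {F G : Fin n → ℕ}
    (hF : Realizable2 h F) (hG : Realizable2 h G) : Realizable2 h (F + G) := by
  obtain ⟨M, c, hc, hcF⟩ := hF
  obtain ⟨N, d, hd, hdG⟩ := hG
  refine ⟨M + N, Fin.append c d, fun μ => ?_, fun i => ?_⟩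
  · induction μ using Fin.addCases <;> simp [hc, hd]
  · simp only [Pi.add_apply, hcF, hdG, card_filter, Fin.sum_univ_add, Fin.append_left,
      Fin.append_right]

theorem realizable2_zero {n : ℕ} (h : Fin n → ZMod 2) : Realizable2 h 0 :=
  ⟨0, Fin.elim0, fun μ => μ.elim0, fun _ => by simp⟩

theorem realizable2_indicator {n : ℕ} {h : Fin n → ZMod 2} {T : Finset (Fin n)}
    (hT : ∑ i ∈ T, h i = 0) : Realizable2 h fun i => if i ∈ T then 1 else 0 := by
  refine ⟨1, fun _ i => if i ∈ T then 1 else 0, fun _ => by simpa using hT, fun i => ?_⟩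
  by_cases hi : i ∈ T <;> simp [hi]

theorem CheckCond.realizable2 {n : ℕ} {h : Fin n → ZMod 2} {F : Fin n → ℕ}
    (hF : CheckCond h F) : Realizable2 h F := by
  induction hN : ∑ i, F i using Nat.strong_induction_on generalizing F with
  | _ N ih =>
  subst hN
  have peel (T : Finset (Fin n)) (hT : ∑ i ∈ T, h i = 0) (hne : T.Nonempty)
      (hpos : ∀ i ∈ T, 0 < F i)
      (hcond : CheckCond h fun i => F i - if i ∈ T then 1 else 0) : Realizable2 h F := by
    have hrest := ih (∑ i, (F i - if i ∈ T then 1 else 0)) (by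
      obtain ⟨t, ht⟩ := hne
      refine sum_lt_sum (fun i _ => Nat.sub_le _ _) ⟨t, mem_univ t, ?_⟩
      have := hpos t ht
      simp only [ht, if_true]
      omega) hcond rfl
    convert hrest.add (realizable2_indicator hT) using 1
    funext i
    by_cases hi : i ∈ T
    · have := hpos i hi
      simp only [Pi.add_apply, hi, if_true]
      omega
    · simp [hi]
  by_cases hout : ∃ i ∉ checkSupport h, 0 < F i
  · obtain ⟨t, ht, htpos⟩ := hout
    have hsame : ∀ i ∈ checkSupport h,
        (F i - if i ∈ ({t} : Finset (Fin n)) then 1 else 0) = F i := by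
      intro i hi
      have : i ≠ t := fun e => ht (e ▸ hi)
      simp [this]
    refine peel {t} (by simpa [checkSupport] using ht) (singleton_nonempty t) (by simpa) ?_
    rw [CheckCond, sum_congr rfl hsame]
    exact ⟨fun l hl => by simpa only [hsame l hl] using hF.1 l hl, hF.2⟩
  push Not at hout
  by_cases hzero : ∀ i ∈ checkSupport h, F i = 0
  · have : F = 0 := by
      funext i
      by_cases hi : i ∈ checkSupport h
      · exact hzero i hi
      · exact Nat.le_zero.mp (hout i hi)
    exact this ▸ realizable2_zero h
  push Not at hzero
  obtain ⟨a₀, ha₀, ha₀pos⟩ := hzero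
  obtain ⟨a, ha, hmax⟩ := exists_max_image (checkSupport h) F ⟨a₀, ha₀⟩
  have hapos : 0 < F a := (Nat.pos_of_ne_zero ha₀pos).trans_le (hmax a₀ ha₀)
  have hsplit := add_sum_erase (checkSupport h) F ha
  have hrest : 0 < ∑ i ∈ (checkSupport h).erase a, F i := by
    have := hF.1 a ha
    omega
  obtain ⟨b, hb, hbpos⟩ := (sum_pos_iff).mp hrest
  obtain ⟨hba, hbS⟩ := mem_erase.mp hb
  have hsub : ({a, b} : Finset (Fin n)) ⊆ checkSupport h := by
    simp [insert_subset_iff, ha, hbS]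
  have hpos : ∀ i ∈ ({a, b} : Finset (Fin n)), 0 < F i := by simp [hapos, hbpos]
  have hsum : ∑ i ∈ checkSupport h, (F i - if i ∈ ({a, b} : Finset (Fin n)) then 1 else 0) + 2
      = ∑ i ∈ checkSupport h, F i := by
    have hcard : ∑ i ∈ checkSupport h, (if i ∈ ({a, b} : Finset (Fin n)) then 1 else 0) = 2 := by
      rw [← card_filter, filter_mem_eq_inter, inter_eq_right.mpr hsub, card_pair hba.symm]
    rw [← hcard, ← sum_add_distrib]
    refine sum_congr rfl fun i _ => Nat.sub_add_cancel ?_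
    split_ifs with hi
    · exact hpos i hi
    · exact Nat.zero_le _
  obtain ⟨k, hk⟩ := hF.2
  refine peel {a, b} ?_ ⟨a, by simp⟩ hpos ⟨fun l hl => ?_, ⟨k - 1, by beta_reduce; omega⟩⟩
  · rw [sum_pair hba.symm, eq_one_of_mem_checkSupport ha, eq_one_of_mem_checkSupport hbS]
    decide
  · have hl2 := hF.1 l hl
    by_cases hlT : l ∈ ({a, b} : Finset (Fin n))
    · simp only [hlT, if_true] at hsum ⊢
      omega
    · have hla : l ≠ a := fun e => hlT (by simp [e])
      have hlb : l ≠ b := fun e => hlT (by simp [e])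
      have hlmem : l ∈ ((checkSupport h).erase a).erase b := by simp [hl, hla, hlb]
      have hle := single_le_sum (f := F) (fun i _ => Nat.zero_le _) hlmem
      have hsplit' := add_sum_erase _ F hb
      have := hmax l hl
      simp only [hlT, if_false, Nat.sub_zero]
      omega

theorem realizable2_iff_checkCond {n : ℕ} (h : Fin n → ZMod 2) (F : Fin n → ℕ) :
    Realizable2 h F ↔ CheckCond h F :=
  ⟨Realizable2.checkCond, CheckCond.realizable2⟩

theorem natCast_le_sum_erase_iff {n : ℕ} {S : Finset (Fin n)} (F : Fin n → ℕ) {l : Fin n}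
    (hl : l ∈ S) : (F l : ℝ) ≤ ∑ i ∈ S.erase l, (F i : ℝ) ↔ 2 * F l ≤ ∑ i ∈ S, F i := by
  rw [← add_sum_erase S F hl, ← Nat.cast_sum, Nat.cast_le]
  omega

theorem sum_val_mul_emod_two_iff {n : ℕ} (h : Fin n → ZMod 2) (F : Fin n → ℕ) :
    (∑ i, ((h i).val : ℤ) * (F i : ℤ)) % 2 = 0 ↔ Even (∑ i ∈ checkSupport h, F i) := by
  have : ∑ i, ((h i).val : ℤ) * (F i : ℤ) = ((∑ i ∈ checkSupport h, F i : ℕ) : ℤ) := by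
    rw [checkSupport, sum_filter, Nat.cast_sum]
    refine sum_congr rfl fun i _ => ?_
    split_ifs with hi
    · rw [zmod_two_eq_one_of_ne_zero hi]
      simp [ZMod.val_one]
    · simp [not_not.mp hi]
  rw [this, ← Int.even_iff, Int.even_coe_nat]

/-- Theorem 1 (Koetter et al.): a nonnegative integer vector `F` is an unscaled
graph-cover pseudocodeword of the binary code with parity-check matrix `H`
(equivalently, realizable over every single parity-check code `C_j`)
iff `F ∈ K_2(H)` and `H·F^T ≡ 0 (mod 2)`. -/
theorem binary_pseudocodeword_characterization {m n : ℕ}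
    (H : Matrix (Fin m) (Fin n) (ZMod 2)) (F : Fin n → ℕ) :
    (∀ j : Fin m, Realizable2 (H j) F) ↔
      ((fun i => (F i : ℝ)) ∈ binaryCone H ∧ mod2Cond H F) := by
  simp only [realizable2_iff_checkCond, CheckCond, forall_and, binaryCone, Set.mem_ofPred_eq,
    mod2Cond, sum_val_mul_emod_two_iff]
  refine and_congr_left' ?_
  rw [and_iff_left fun i => Nat.cast_nonneg (F i)]
  exact forall_congr' fun j => forall₂_congr fun l hl => (natCast_le_sum_erase_iff F hl).symm
end

section
/- Let H be an m×n parity-check matrix over the binary field F_2, and let z ∈ K_2(H) be a real vector of length n in the binary fundamental cone. Then for every ε > 0 there exist a real number c > 0 and a nonnegative integer vector F of length n with F ∈ K_2(H) and H·F^T ≡ 0 (mod 2) (H regarded as a 0/1 integer matrix; i.e., F is an unscaled graph-cover pseudocodeword vector) such that ‖c·F − z‖ < ε. -/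
open Finset

/-- Rounding every coordinate of a point of the cone up and doubling stays in the cone. -/
theorem two_mul_ceil_mem_binaryCone {m n : ℕ} {H : Matrix (Fin m) (Fin n) (ZMod 2)}
    {f : Fin n → ℝ} (hf : f ∈ binaryCone H) :
    (fun i => ((2 * ⌈f i⌉₊ : ℕ) : ℝ)) ∈ binaryCone H := by
  refine ⟨fun j ℓ hℓ => ?_, fun i => Nat.cast_nonneg _⟩
  have h : ⌈f ℓ⌉₊ ≤ ∑ i ∈ (suppRow2 H j).erase ℓ, ⌈f i⌉₊ := by
    rw [Nat.ceil_le]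
    push_cast
    exact (hf.1 j ℓ hℓ).trans (Finset.sum_le_sum fun i _ => Nat.le_ceil (f i))
  rw [← Nat.cast_sum, ← Finset.mul_sum]
  exact Nat.cast_le.mpr (Nat.mul_le_mul_left 2 h)

theorem smul_mem_binaryCone {m n : ℕ} {H : Matrix (Fin m) (Fin n) (ZMod 2)}
    {f : Fin n → ℝ} (hf : f ∈ binaryCone H) {t : ℝ} (ht : 0 ≤ t) :
    (fun i => t * f i) ∈ binaryCone H := by
  refine ⟨fun j ℓ hℓ => ?_, fun i => mul_nonneg ht (hf.2 i)⟩
  rw [← Finset.mul_sum]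
  exact mul_le_mul_of_nonneg_left (hf.1 j ℓ hℓ) ht

theorem mod2Cond_two_mul {m n : ℕ} (H : Matrix (Fin m) (Fin n) (ZMod 2)) (G : Fin n → ℕ) :
    mod2Cond H fun i => 2 * G i := by
  intro j
  refine Int.emod_eq_zero_of_dvd (Finset.dvd_sum fun i _ => ?_)
  push_cast
  exact ((dvd_mul_right 2 _).mul_left _)

theorem sq_two_mul_ceil_sub_le {t x : ℝ} (ht : 0 < t) (hx : 0 ≤ x) :
    (1 / (2 * t) * ((2 * ⌈t * x⌉₊ : ℕ) : ℝ) - x) ^ 2 ≤ (1 / t) ^ 2 := by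
  have h1 := Nat.le_ceil (t * x)
  have h2 := Nat.ceil_lt_add_one (mul_nonneg ht.le hx)
  have h3 : 1 / (2 * t) * ((2 * ⌈t * x⌉₊ : ℕ) : ℝ) - x = (⌈t * x⌉₊ - t * x) / t := by
    push_cast
    field_simp
  rw [h3]
  exact pow_le_pow_left₀ (div_nonneg (by linarith) ht.le)
    (div_le_div_of_nonneg_right (by linarith) ht.le) 2

/-- Theorem 2 (Koetter et al.): for every `z ∈ K_2(H)` and `ε > 0` there are
`c > 0` and an unscaled graph-cover pseudocodeword vector `F` with
`‖c·F − z‖ < ε` (Euclidean norm on `ℝ^n`). -/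
theorem binary_cone_density {m n : ℕ} (H : Matrix (Fin m) (Fin n) (ZMod 2))
    (z : Fin n → ℝ) (hz : z ∈ binaryCone H) :
    ∀ ε : ℝ, 0 < ε → ∃ (c : ℝ) (F : Fin n → ℕ),
      0 < c ∧
      (fun i => (F i : ℝ)) ∈ binaryCone H ∧
      mod2Cond H F ∧
      Real.sqrt (∑ i : Fin n, (c * (F i : ℝ) - z i) ^ 2) < ε := by
  intro ε hε
  have hn : (0 : ℝ) < n + 1 := by positivity
  have ht : 0 < (n + 1) / ε := div_pos hn hε
  refine ⟨1 / (2 * ((n + 1) / ε)), fun i => 2 * ⌈(n + 1) / ε * z i⌉₊, by positivity,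
    two_mul_ceil_mem_binaryCone (smul_mem_binaryCone hz ht.le), mod2Cond_two_mul H _, ?_⟩
  rw [Real.sqrt_lt' hε]
  refine (Finset.sum_le_sum fun i _ => sq_two_mul_ceil_sub_le ht (hz.2 i)).trans_lt ?_
  rw [Finset.sum_const, Finset.card_univ, Fintype.card_fin, nsmul_eq_mul, one_div_div, div_pow,
    ← mul_div_assoc, div_lt_iff₀ (by positivity), mul_comm]
  gcongr
  nlinarith [(Nat.cast_nonneg n : (0 : ℝ) ≤ n)]
end

section
/- Let H_j be a 1×n parity-check matrix over F_3, let ψ_{H_j} be the column-swapping map, and let H_s be the 1×n matrix obtained from H_j by replacing every nonzero entry with 1. Then for every 2×n real matrix F: F ∈ K_3(H_j) if and only if ψ_{H_j}(F) ∈ K_3(H_s). -/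
open Finset

/-- The map `ψ_{H_j}`: swap the two entries of column `i` exactly when `H_{j,i} = 2`. -/
def psiR {n : ℕ} (Hj : Fin n → ZMod 3) (F : Matrix (Fin 2) (Fin n) ℝ) :
    Matrix (Fin 2) (Fin n) ℝ :=
  Matrix.of fun α i => if Hj i = 2 then F (1 - α) i else F α i

theorem mem_suppRow {m n : ℕ} {H : Matrix (Fin m) (Fin n) (ZMod 3)} {j : Fin m} {i : Fin n} :
    i ∈ suppRow H j ↔ H j i ≠ 0 :=
  mem_filter_univ i

/-- Membership in the ternary cone depends only on the supports of the rows, on the entries of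
the matrix selected by `H` on these supports, and on nonnegativity. -/
theorem ternaryCone_mem_of_entryR_eq {m n : ℕ} {H H' : Matrix (Fin m) (Fin n) (ZMod 3)}
    {F G : Matrix (Fin 2) (Fin n) ℝ} (hsupp : ∀ j, suppRow H j = suppRow H' j)
    (h₁ : ∀ j, ∀ i ∈ suppRow H j, entryR F (H j i) i = entryR G (H' j i) i)
    (h₂ : ∀ j, ∀ i ∈ suppRow H j, entryR F (2 * H j i) i = entryR G (2 * H' j i) i)
    (hG : ∀ α i, 0 ≤ G α i) (hF : F ∈ ternaryCone H) : G ∈ ternaryCone H' := by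
  have sum₁ : ∀ j, ∀ s ⊆ suppRow H j,
      ∑ i ∈ s, entryR F (H j i) i = ∑ i ∈ s, entryR G (H' j i) i :=
    fun j s hs => sum_congr rfl fun i hi => h₁ j i (hs hi)
  have sum₂ : ∀ j, ∀ s ⊆ suppRow H j,
      ∑ i ∈ s, entryR F (2 * H j i) i = ∑ i ∈ s, entryR G (2 * H' j i) i :=
    fun j s hs => sum_congr rfl fun i hi => h₂ j i (hs hi)
  have erase₂ : ∀ j k l, ((suppRow H j).erase k).erase l ⊆ suppRow H j :=
    fun j k l => (erase_subset _ _).trans (erase_subset _ _)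
  obtain ⟨c₁, c₂, c₃, c₄, -⟩ := hF
  refine ⟨fun j l hl => ?_, fun j l hl => ?_, fun j k hk l hl hkl => ?_,
    fun j k hk l hl hkl => ?_, hG⟩
  · rw [← hsupp] at hl ⊢
    rw [← h₁ j l hl, ← h₂ j l hl, ← sum₁ j _ (erase_subset _ _), ← sum₂ j _ (erase_subset _ _)]
    exact c₁ j l hl
  · rw [← hsupp] at hl ⊢
    rw [← h₁ j l hl, ← h₂ j l hl, ← sum₁ j _ (erase_subset _ _), ← sum₂ j _ (erase_subset _ _)]
    exact c₂ j l hl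
  · rw [← hsupp] at hk hl ⊢
    rw [← h₁ j k hk, ← h₁ j l hl, ← sum₁ j _ (erase₂ j k l), ← sum₂ j _ Subset.rfl]
    exact c₃ j k hk l hl hkl
  · rw [← hsupp] at hk hl ⊢
    rw [← h₂ j k hk, ← h₂ j l hl, ← sum₂ j _ (erase₂ j k l), ← sum₁ j _ Subset.rfl]
    exact c₄ j k hk l hl hkl

theorem psiR_nonneg {n : ℕ} (Hj : Fin n → ZMod 3) {F : Matrix (Fin 2) (Fin n) ℝ}
    (hF : ∀ α i, 0 ≤ F α i) (α : Fin 2) (i : Fin n) : 0 ≤ psiR Hj F α i := by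
  simp only [psiR, Matrix.of_apply]
  split_ifs <;> exact hF _ _

theorem psiR_psiR {n : ℕ} (Hj : Fin n → ZMod 3) (F : Matrix (Fin 2) (Fin n) ℝ) :
    psiR Hj (psiR Hj F) = F := by
  ext α i
  simp only [psiR, Matrix.of_apply, sub_sub_cancel]
  split_ifs <;> rfl

theorem entryR_psiR_one {n : ℕ} (Hj : Fin n → ZMod 3) (F : Matrix (Fin 2) (Fin n) ℝ)
    {i : Fin n} (hi : Hj i ≠ 0) : entryR (psiR Hj F) 1 i = entryR F (Hj i) i := by
  have h : Hj i = 1 ∨ Hj i = 2 := by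
    generalize Hj i = a at hi
    revert a
    decide
  have h21 : (2 : ZMod 3) ≠ 1 := by decide
  rcases h with h | h <;> simp [entryR, psiR, h, h21, h21.symm]

theorem entryR_psiR_two {n : ℕ} (Hj : Fin n → ZMod 3) (F : Matrix (Fin 2) (Fin n) ℝ)
    {i : Fin n} (hi : Hj i ≠ 0) : entryR (psiR Hj F) 2 i = entryR F (2 * Hj i) i := by
  have h : Hj i = 1 ∨ Hj i = 2 := by
    generalize Hj i = a at hi
    revert a
    decide
  have h21 : (2 : ZMod 3) ≠ 1 := by decide
  have h22 : (2 * 2 : ZMod 3) = 1 := by decide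
  rcases h with h | h <;> simp [entryR, psiR, h, h21, h21.symm, h22]

/-- Lemma 5(1): `F ∈ K_3(H_j)` iff `ψ_{H_j}(F) ∈ K_3(H_s)`, where `H_s` is
obtained from the 1×n matrix `H_j` by replacing every nonzero entry with `1`. -/
theorem mem_ternaryCone_iff_psi {n : ℕ} (Hj : Fin n → ZMod 3)
    (F : Matrix (Fin 2) (Fin n) ℝ) :
    F ∈ ternaryCone (Matrix.of fun (_ : Fin 1) i => Hj i) ↔
      psiR Hj F ∈
        ternaryCone (Matrix.of fun (_ : Fin 1) i =>
          if Hj i = 0 then (0 : ZMod 3) else 1) := by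
  set H : Matrix (Fin 1) (Fin n) (ZMod 3) := Matrix.of fun _ i => Hj i
  set Hs : Matrix (Fin 1) (Fin n) (ZMod 3) :=
    Matrix.of fun _ i => if Hj i = 0 then 0 else 1
  have hsupp : ∀ j, suppRow H j = suppRow Hs j := fun j => by
    ext i
    simp [mem_suppRow, H, Hs]
  have h₁ : ∀ j, ∀ i ∈ suppRow H j,
      entryR F (H j i) i = entryR (psiR Hj F) (Hs j i) i := fun j i hi => by
    have hi : Hj i ≠ 0 := mem_suppRow.1 hi
    simp [H, Hs, hi, entryR_psiR_one Hj F hi]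
  have h₂ : ∀ j, ∀ i ∈ suppRow H j,
      entryR F (2 * H j i) i = entryR (psiR Hj F) (2 * Hs j i) i := fun j i hi => by
    have hi : Hj i ≠ 0 := mem_suppRow.1 hi
    simp [H, Hs, hi, entryR_psiR_two Hj F hi]
  constructor <;> intro hF
  · exact ternaryCone_mem_of_entryR_eq hsupp h₁ h₂ (psiR_nonneg Hj hF.2.2.2.2) hF
  · refine ternaryCone_mem_of_entryR_eq (fun j => (hsupp j).symm)
      (fun j i hi => (h₁ j i (hsupp j ▸ hi)).symm)
      (fun j i hi => (h₂ j i (hsupp j ▸ hi)).symm) ?_ hF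
    simpa only [psiR_psiR] using psiR_nonneg Hj hF.2.2.2.2
end

section
/- Let H_j be a 1×n parity-check matrix over F_3, let C_j = {c ∈ F_3^n : c·H_j^T = 0}, let H_s be the 1×n matrix obtained from H_j by replacing every nonzero entry with 1, and let C_s = {c ∈ F_3^n : c·H_s^T = 0}. Then for every 2×n nonnegative integer matrix F: F is realizable over C_j if and only if ψ_{H_j}(F) is realizable over C_s. (Equivalently: F is an unscaled graph-cover pseudocodeword matrix with respect to H_j if and only if ψ_{H_j}(F) is an unscaled graph-cover pseudocodeword matrix with respect to H_s.) -/
open Finset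

/-- The map `ψ_{H_j}` on nonnegative integer matrices: swap the two entries of
column `i` exactly when `H_{j,i} = 2`. -/
def psiN {n : ℕ} (Hj : Fin n → ZMod 3) (F : Matrix (Fin 2) (Fin n) ℕ) :
    Matrix (Fin 2) (Fin n) ℕ :=
  Matrix.of fun α i => if Hj i = 2 then F (1 - α) i else F α i

/-- Negating the parity-check coefficients at the coordinates in `P` corresponds to swapping
the two entries of the columns in `P`. -/
theorem Realizable3.negate_columns {n : ℕ} {H H' : Fin n → ZMod 3}
    {F G : Matrix (Fin 2) (Fin n) ℕ} (P : Fin n → Prop) [DecidablePred P]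
    (hH : ∀ i, H' i = if P i then -H i else H i)
    (hG : ∀ α i, G α i = if P i then F (1 - α) i else F α i)
    (h : Realizable3 H F) : Realizable3 H' G := by
  obtain ⟨M, c, hc, h1, h2⟩ := h
  have neg_eq_one : ∀ x : ZMod 3, -x = 1 ↔ x = 2 := by decide
  have neg_eq_two : ∀ x : ZMod 3, -x = 2 ↔ x = 1 := by decide
  refine ⟨M, fun μ i => if P i then -c μ i else c μ i, fun μ => ?_, fun i => ?_, fun i => ?_⟩
  · rw [← hc μ]
    refine Finset.sum_congr rfl fun i _ => ?_
    rw [hH]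
    by_cases hP : P i <;> simp [hP]
  · rw [hG]
    by_cases hP : P i
    · simpa [hP, neg_eq_one] using h2 i
    · simpa [hP] using h1 i
  · rw [hG]
    by_cases hP : P i
    · simpa [hP, neg_eq_two] using h1 i
    · simpa [hP] using h2 i

/-- Lemma 5(2): `F` is realizable over `C_j` (i.e., an unscaled graph-cover
pseudocodeword matrix w.r.t. `H_j`) iff `ψ_{H_j}(F)` is realizable over the code
checked by `H_s`, where `H_s` is obtained from `H_j` by replacing every nonzero
entry with `1`. -/
theorem realizable_iff_psi {n : ℕ} (Hj : Fin n → ZMod 3)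
    (F : Matrix (Fin 2) (Fin n) ℕ) :
    Realizable3 Hj F ↔
      Realizable3 (fun i => if Hj i = 0 then (0 : ZMod 3) else 1) (psiN Hj F) := by
  have unit_eq : ∀ x : ZMod 3,
      (if x = 0 then (0 : ZMod 3) else 1) = if x = 2 then -x else x := by decide
  have eq_unit : ∀ x : ZMod 3,
      x = if x = 2 then -(if x = 0 then (0 : ZMod 3) else 1)
        else (if x = 0 then (0 : ZMod 3) else 1) := by decide
  refine ⟨Realizable3.negate_columns (fun i => Hj i = 2) (fun i => unit_eq (Hj i))
    fun _ _ => rfl, Realizable3.negate_columns (fun i => Hj i = 2) (fun i => eq_unit (Hj i))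
    fun α i => ?_⟩
  by_cases h : Hj i = 2 <;> simp [psiN, h]
end

section
/- Let H_s be a 1×n parity-check matrix over F_3 all of whose entries lie in {0,1}, with support I_s, and let F = (f_i^(α)) be a 2×n nonnegative integer matrix with F ∈ K_3(H_s). Suppose f_i^(2) = 0 for all i ∈ {1,…,n} and Σ_{i∈I_s} f_i^(1) ≡ 0 (mod 3). Then there exist M ∈ ℕ and subsets S_1, S_2, …, S_M ⊆ I_s such that |S_μ| ≡ 0 (mod 3) for every μ ∈ {1,…,M}, and for every index i ∈ I_s the number of sets S_μ containing i equals f_i^(1). -/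
open Finset

/-- A multiplicity function on `s` bounded by `m` and with total weight `k * m` is the sum of the
indicator functions of `m` subsets of `s`, each of size `k`. -/
theorem exists_uniform_family_of_multiplicity {α : Type*} [DecidableEq α] (s : Finset α) (k m : ℕ)
    (f : α → ℕ) (hle : ∀ i ∈ s, f i ≤ m) (hsum : ∑ i ∈ s, f i = k * m) :
    ∃ S : Fin m → Finset α, (∀ μ, S μ ⊆ s) ∧ (∀ μ, (S μ).card = k) ∧
      ∀ i ∈ s, (Finset.univ.filter fun μ => i ∈ S μ).card = f i := by
  induction m generalizing f with
  | zero =>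
    refine ⟨fun _ => ∅, fun μ => μ.elim0, fun μ => μ.elim0, fun i hi => ?_⟩
    have := hle i hi
    simp; omega
  | succ m ih =>
    have hmax : (s.filter fun i => f i = m + 1).card ≤ k := by
      refine Nat.le_of_mul_le_mul_right (c := m + 1) ?_ m.succ_pos
      rw [← hsum, ← smul_eq_mul]
      calc _ ≤ ∑ i ∈ s.filter fun i => f i = m + 1, f i :=
            Finset.card_nsmul_le_sum _ _ _ fun i hi => (Finset.mem_filter.1 hi).2.ge
        _ ≤ _ := Finset.sum_le_sum_of_subset (Finset.filter_subset _ _)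
    have hpos : k ≤ (s.filter fun i => f i ≠ 0).card := by
      refine Nat.le_of_mul_le_mul_right (c := m + 1) ?_ m.succ_pos
      rw [← hsum, ← Finset.sum_filter_ne_zero, ← smul_eq_mul]
      exact Finset.sum_le_card_nsmul _ _ _ fun i hi => hle i (Finset.mem_filter.1 hi).1
    obtain ⟨U, hTU, hUP, hU⟩ := Finset.exists_subsuperset_card_eq
      (Finset.monotone_filter_right s fun i _ (h : f i = m + 1) => (by omega : f i ≠ 0)) hmax hpos
    have hUs : U ⊆ s := hUP.trans (Finset.filter_subset _ _)
    have hsplit : ∀ i, f i = (if i ∈ U then 1 else 0) + (f i - if i ∈ U then 1 else 0) := by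
      intro i
      split_ifs with h
      · have := (Finset.mem_filter.1 (hUP h)).2
        omega
      · omega
    obtain ⟨S, hSs, hSk, hS⟩ := ih (fun i => f i - if i ∈ U then 1 else 0)
      (fun i hi => by
        have := hle i hi
        by_cases h : i ∈ U
        · simp only [h, if_true]; omega
        · have : f i ≠ m + 1 := fun hf => h (hTU (Finset.mem_filter.2 ⟨hi, hf⟩))
          simp only [h, if_false]; omega)
      (by
        rw [Finset.sum_congr rfl fun i _ => hsplit i, Finset.sum_add_distrib,
          Finset.sum_ite_mem, Finset.inter_eq_right.2 hUs, Finset.sum_const, hU, mul_add] at hsum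
        simp only [smul_eq_mul, mul_one] at hsum
        omega)
    refine ⟨Fin.cons U S, Fin.cases hUs hSs, Fin.cases hU hSk, fun i hi => ?_⟩
    rw [Finset.card_filter, Fin.sum_univ_succ]
    simp only [Fin.cons_zero, Fin.cons_succ]
    rw [← Finset.card_filter, hS i hi, ← hsplit]

/-- Lemma 6: if `F ∈ K_3(H_s)` is a nonnegative integer matrix with all entries
of `H_s` in `{0,1}`, second row of `F` identically zero, and the sum of the
first row over the support `I_s` divisible by 3, then there are subsets
`S_1, …, S_M ⊆ I_s`, each of size divisible by 3, such that every `i ∈ I_s`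
belongs to exactly `f_i^(1)` of them. -/
theorem one_type_decomposition {n : ℕ} (Hs : Fin n → ZMod 3)
    (hHs : ∀ i, Hs i = 0 ∨ Hs i = 1)
    (F : Matrix (Fin 2) (Fin n) ℕ)
    (hcone : F.map (fun x => (x : ℝ)) ∈ ternaryCone (Matrix.of fun (_ : Fin 1) i => Hs i))
    (hrow2 : ∀ i, F 1 i = 0)
    (hsum : (∑ i ∈ Finset.univ.filter (fun i => Hs i ≠ 0), F 0 i) % 3 = 0) :
    ∃ (M : ℕ) (S : Fin M → Finset (Fin n)),
      (∀ μ, S μ ⊆ Finset.univ.filter (fun i => Hs i ≠ 0)) ∧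
      (∀ μ, (S μ).card % 3 = 0) ∧
      (∀ i ∈ Finset.univ.filter (fun i => Hs i ≠ 0),
        (Finset.univ.filter fun μ => i ∈ S μ).card = F 0 i) := by
  set I := Finset.univ.filter (fun i => Hs i ≠ 0) with hI
  have hle : ∀ l ∈ I, 3 * F 0 l ≤ ∑ i ∈ I, F 0 i := by
    intro l hl
    have hone : ∀ i ∈ I, Hs i = 1 := fun i hi =>
      (hHs i).resolve_left (Finset.mem_filter.1 hi).2
    have htwo : (2 : ZMod 3) ≠ 1 := by decide
    have h := hcone.1 0 l hl
    have hsupp : suppRow (Matrix.of fun (_ : Fin 1) i => Hs i) 0 = I := rfl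
    have h₁ : ∑ i ∈ I.erase l, entryR (F.map fun x => (x : ℝ)) (Hs i) i
        = ∑ i ∈ I.erase l, (F 0 i : ℝ) :=
      Finset.sum_congr rfl fun i hi => by
        simp [entryR, hone i (Finset.mem_of_mem_erase hi)]
    have h₂ : ∑ i ∈ I.erase l, entryR (F.map fun x => (x : ℝ)) (2 * Hs i) i = 0 :=
      Finset.sum_eq_zero fun i hi => by
        simp [entryR, hone i (Finset.mem_of_mem_erase hi), htwo, hrow2]
    simp only [hsupp, Matrix.of_apply, h₁, h₂] at h
    simp only [entryR, hone l hl, mul_one, if_true, htwo, if_false, Matrix.map_apply, hrow2,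
      Nat.cast_zero, add_zero, mul_zero, zero_add] at h
    have h' : 2 * F 0 l ≤ ∑ i ∈ I.erase l, F 0 i := by exact_mod_cast h
    rw [← Finset.add_sum_erase _ _ hl]
    omega
  obtain ⟨S, hSI, hS3, hS⟩ := exists_uniform_family_of_multiplicity I 3
    ((∑ i ∈ I, F 0 i) / 3) (F 0) (fun l hl => by have := hle l hl; omega) (by omega)
  exact ⟨_, S, hSI, fun μ => by rw [hS3 μ], hS⟩
end

section
/- Let H_1 be a 1×n parity-check matrix over F_3 with support I_1, and let F = (f_i^(α)) be a 2×n nonnegative integer matrix with F ∈ K_3(H_1) satisfying, with H_1 regarded as an integer matrix with entries in {0,1,2}, H_1·(F_1^T + 2·F_2^T) ≡ 0 (mod 3), where F_1, F_2 are the rows of F. Suppose ℓ ∈ I_1 is a critical coordinate of type one, i.e., f_ℓ^(1) + f_ℓ^(2) ≥ 1 and 2·Σ_{i∈I_1\{ℓ}} f_i^(2H_{1,i}) + Σ_{i∈I_1\{ℓ}} f_i^(H_{1,i}) < 2·f_ℓ^(H_{1,ℓ}) + f_ℓ^(2H_{1,ℓ}) + 3. Then the corresponding cone inequality holds with equality: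 2·Σ_{i∈I_1\{ℓ}} f_i^(2H_{1,i}) + Σ_{i∈I_1\{ℓ}} f_i^(H_{1,i}) = 2·f_ℓ^(H_{1,ℓ}) + f_ℓ^(2H_{1,ℓ}). -/
open Finset

/-- Integer-valued version of `entryR` for a matrix of natural numbers. -/
def entryZ {n : ℕ} (F : Matrix (Fin 2) (Fin n) ℕ) (α : ZMod 3) (i : Fin n) : ℤ :=
  if α = 1 then F 0 i else F 1 i

lemma entryR_map_natCast {n : ℕ} (F : Matrix (Fin 2) (Fin n) ℕ) (α : ZMod 3) (i : Fin n) :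
    entryR (F.map (fun x => (x : ℝ))) α i = entryZ F α i := by
  unfold entryR entryZ
  split_ifs <;> simp

lemma entryZ_modEq {n : ℕ} (F : Matrix (Fin 2) (Fin n) ℕ) {α : ZMod 3} (hα : α ≠ 0)
    (i : Fin n) :
    2 * entryZ F (2 * α) i + entryZ F α i
      ≡ (α.val : ℤ) * ((F 0 i : ℤ) + 2 * (F 1 i : ℤ)) [ZMOD 3] := by
  have h : α = 1 ∨ α = 2 := by revert α; decide
  rcases h with rfl | rfl
  · have h1 : (2 * 1 : ZMod 3) ≠ 1 := by decide
    have h2 : (1 : ZMod 3).val = 1 := rfl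
    simp only [entryZ, h1, h2, if_true, if_false, Int.ModEq]
    lia
  · have h1 : (2 * 2 : ZMod 3) = 1 := by decide
    have h2 : (2 : ZMod 3).val = 2 := rfl
    have h3 : (2 : ZMod 3) ≠ 1 := by decide
    simp only [entryZ, h1, h2, h3, if_true, if_false, Int.ModEq]
    lia

lemma three_dvd_sum_entryZ {m n : ℕ} {H : Matrix (Fin m) (Fin n) (ZMod 3)}
    {F : Matrix (Fin 2) (Fin n) ℕ} (hmod : mod3Cond H F) (j : Fin m) :
    (3 : ℤ) ∣ ∑ i ∈ suppRow H j, (2 * entryZ F (2 * H j i) i + entryZ F (H j i) i) := by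
  have hsum : ∑ i ∈ suppRow H j, ((H j i).val : ℤ) * ((F 0 i : ℤ) + 2 * (F 1 i : ℤ))
      = ∑ i, ((H j i).val : ℤ) * ((F 0 i : ℤ) + 2 * (F 1 i : ℤ)) := by
    refine Finset.sum_subset (Finset.subset_univ _) fun i _ hi => ?_
    have h0 : H j i = 0 := by simpa [suppRow] using hi
    simp [h0]
  have hdvd := Int.dvd_of_emod_eq_zero (hmod j)
  rw [← hsum] at hdvd
  refine (Int.ModEq.dvd_iff ?_).mpr hdvd
  refine Int.ModEq.sum fun i hi => entryZ_modEq F ?_ i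
  simpa [suppRow] using hi

/-- Lemma 8, case of a critical coordinate of type one: for a nonnegative
integer matrix `F ∈ K_3(H_1)` satisfying `H_1·(F_1^T + 2 F_2^T) ≡ 0 (mod 3)`,
a critical inequality of type one at a coordinate `ℓ ∈ I_1` holds with
equality. -/
theorem critical_coordinate_type_one {n : ℕ} (H : Matrix (Fin 1) (Fin n) (ZMod 3))
    (F : Matrix (Fin 2) (Fin n) ℕ)
    (hcone : F.map (fun x => (x : ℝ)) ∈ ternaryCone H)
    (hmod : mod3Cond H F)
    (ℓ : Fin n) (hℓ : ℓ ∈ suppRow H 0)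
    (hpos : 1 ≤ F 0 ℓ + F 1 ℓ)
    (hcrit :
      2 * ∑ i ∈ (suppRow H 0).erase ℓ, entryR (F.map (fun x => (x : ℝ))) (2 * H 0 i) i
        + ∑ i ∈ (suppRow H 0).erase ℓ, entryR (F.map (fun x => (x : ℝ))) (H 0 i) i
      < 2 * entryR (F.map (fun x => (x : ℝ))) (H 0 ℓ) ℓ
        + entryR (F.map (fun x => (x : ℝ))) (2 * H 0 ℓ) ℓ + 3) :
    2 * ∑ i ∈ (suppRow H 0).erase ℓ, entryR (F.map (fun x => (x : ℝ))) (2 * H 0 i) i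
      + ∑ i ∈ (suppRow H 0).erase ℓ, entryR (F.map (fun x => (x : ℝ))) (H 0 i) i
    = 2 * entryR (F.map (fun x => (x : ℝ))) (H 0 ℓ) ℓ
      + entryR (F.map (fun x => (x : ℝ))) (2 * H 0 ℓ) ℓ := by
  have hdvd := three_dvd_sum_entryZ hmod 0
  rw [← Finset.add_sum_erase _ _ hℓ, Finset.sum_add_distrib, ← Finset.mul_sum] at hdvd
  have hle := hcone.1 0 ℓ hℓ
  simp only [entryR_map_natCast] at hle hcrit ⊢
  norm_cast at hle hcrit ⊢
  omega
end

section
/- Let H_1 be a 1×n parity-check matrix over F_3 with support I_1, and let F = (f_i^(α)) be a 2×n nonnegative integer matrix with F ∈ K_3(H_1) satisfying, with H_1 regarded as an integer matrix with entries in {0,1,2}, H_1·(F_1^T + 2·F_2^T) ≡ 0 (mod 3), where F_1, F_2 are the rows of F. Suppose the pair of distinct coordinates {k,ℓ} ⊆ I_1 is critical of type one, i.e., f_k^(H_{1,k}) ≥ 1, f_ℓ^(H_{1,ℓ}) ≥ 1, and 2·Σ_{i∈I_1\{k,ℓ}} f_i^(H_{1,i}) + Σ_{i∈I_1} f_i^(2H_{1,i})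 < f_k^(H_{1,k}) + f_ℓ^(H_{1,ℓ}) + 3. Then the corresponding cone inequality holds with equality: 2·Σ_{i∈I_1\{k,ℓ}} f_i^(H_{1,i}) + Σ_{i∈I_1} f_i^(2H_{1,i}) = f_k^(H_{1,k}) + f_ℓ^(H_{1,ℓ}). -/
open Finset

/-- The entry of an integer matrix matching the one selected by `entryR`. -/
def entryInt {n : ℕ} (F : Matrix (Fin 2) (Fin n) ℕ) (α : ZMod 3) (i : Fin n) : ℤ :=
  if α = 1 then F 0 i else F 1 i

lemma entryR_map_eq_cast {n : ℕ} (F : Matrix (Fin 2) (Fin n) ℕ) (α : ZMod 3) (i : Fin n) :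
    entryR (F.map (fun x => (x : ℝ))) α i = (entryInt F α i : ℝ) := by
  unfold entryR entryInt
  split_ifs <;> simp

/-- Multiplying a column by a nonzero coefficient relabels its two entries modulo 3. -/
lemma val_mul_modEq_entryInt {n : ℕ} (F : Matrix (Fin 2) (Fin n) ℕ) {α : ZMod 3} (hα : α ≠ 0)
    (i : Fin n) :
    (α.val : ℤ) * ((F 0 i : ℤ) + 2 * (F 1 i : ℤ)) ≡
      entryInt F α i + 2 * entryInt F (2 * α) i [ZMOD 3] := by
  have h : α = 1 ∨ α = 2 := by
    revert α
    decide
  rcases h with rfl | rfl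
  · have h2 : ¬ (2 * 1 : ZMod 3) = 1 := by decide
    have hv : (1 : ZMod 3).val = 1 := rfl
    simp only [entryInt, if_true, if_neg h2, hv, Int.ModEq]
    omega
  · have h1 : ¬ (2 : ZMod 3) = 1 := by decide
    have h2 : (2 * 2 : ZMod 3) = 1 := by decide
    have hv : (2 : ZMod 3).val = 2 := rfl
    simp only [entryInt, if_neg h1, if_pos h2, hv, Int.ModEq]
    omega

/-- The congruence `H·(F_1^T + 2 F_2^T) ≡ 0` in terms of the relabelled entries on the support. -/
lemma mod3Cond.sum_suppRow_modEq {m n : ℕ} {H : Matrix (Fin m) (Fin n) (ZMod 3)}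
    {F : Matrix (Fin 2) (Fin n) ℕ} (h : mod3Cond H F) (j : Fin m) :
    ∑ i ∈ suppRow H j, entryInt F (H j i) i + 2 * ∑ i ∈ suppRow H j, entryInt F (2 * H j i) i
      ≡ 0 [ZMOD 3] := by
  have hsupp : ∑ i ∈ suppRow H j, ((H j i).val : ℤ) * ((F 0 i : ℤ) + 2 * (F 1 i : ℤ)) =
      ∑ i, ((H j i).val : ℤ) * ((F 0 i : ℤ) + 2 * (F 1 i : ℤ)) := by
    refine Finset.sum_subset (Finset.subset_univ _) fun i _ hi => ?_
    have h0 : H j i = 0 := by simpa [suppRow] using hi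
    simp [h0]
  rw [Finset.mul_sum, ← Finset.sum_add_distrib]
  refine Int.ModEq.trans (Int.ModEq.sum fun i hi => ?_) ((hsupp ▸ h j :) : _ ≡ 0 [ZMOD 3])
  exact (val_mul_modEq_entryInt F (by simpa [suppRow] using hi) i).symm

/-- Lemma 8, case of a critical pair of coordinates of type one: for a
nonnegative integer matrix `F ∈ K_3(H_1)` satisfying
`H_1·(F_1^T + 2 F_2^T) ≡ 0 (mod 3)`, a critical inequality of type one at a
pair of distinct coordinates `{k, ℓ} ⊆ I_1` holds with equality. -/
theorem critical_pair_type_one {n : ℕ} (H : Matrix (Fin 1) (Fin n) (ZMod 3))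
    (F : Matrix (Fin 2) (Fin n) ℕ)
    (hcone : F.map (fun x => (x : ℝ)) ∈ ternaryCone H)
    (hmod : mod3Cond H F)
    (k ℓ : Fin n) (hk : k ∈ suppRow H 0) (hℓ : ℓ ∈ suppRow H 0) (hkl : k ≠ ℓ)
    (hfk : 1 ≤ entryR (F.map (fun x => (x : ℝ))) (H 0 k) k)
    (hfl : 1 ≤ entryR (F.map (fun x => (x : ℝ))) (H 0 ℓ) ℓ)
    (hcrit :
      2 * ∑ i ∈ ((suppRow H 0).erase k).erase ℓ, entryR (F.map (fun x => (x : ℝ))) (H 0 i) i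
        + ∑ i ∈ suppRow H 0, entryR (F.map (fun x => (x : ℝ))) (2 * H 0 i) i
      < entryR (F.map (fun x => (x : ℝ))) (H 0 k) k
        + entryR (F.map (fun x => (x : ℝ))) (H 0 ℓ) ℓ + 3) :
    2 * ∑ i ∈ ((suppRow H 0).erase k).erase ℓ, entryR (F.map (fun x => (x : ℝ))) (H 0 i) i
      + ∑ i ∈ suppRow H 0, entryR (F.map (fun x => (x : ℝ))) (2 * H 0 i) i
    = entryR (F.map (fun x => (x : ℝ))) (H 0 k) k
      + entryR (F.map (fun x => (x : ℝ))) (H 0 ℓ) ℓ := by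
  have hge := hcone.2.2.1 0 k hk ℓ hℓ hkl
  have hsum := hmod.sum_suppRow_modEq 0
  have hk' := Finset.add_sum_erase (suppRow H 0) (fun i => entryInt F (H 0 i) i) hk
  have hl' := Finset.add_sum_erase ((suppRow H 0).erase k) (fun i => entryInt F (H 0 i) i)
    (Finset.mem_erase.2 ⟨hkl.symm, hℓ⟩)
  simp only [entryR_map_eq_cast] at hge hcrit ⊢
  norm_cast at hge hcrit ⊢
  simp only [Int.ModEq] at hsum
  omega
end

section
/- Let H_j be a 1×n parity-check matrix over F_3 and let C_j = {c ∈ F_3^n : c·H_j^T = 0}. If a 2×n nonnegative integer matrix F is realizable over C_j — i.e., there exist M ∈ ℕ and codewords c^(1),…,c^(M) ∈ C_j with f_i^(α) = |{μ : c^(μ)_i = α}| for all i ∈ {1,…,n} and α ∈ {1,2} — then F ∈ K_3(H_j) and, regarding H_j as an integer matrix with entries in {0,1,2}, H_j·(F_1^T + 2·F_2^T) ≡ 0 (mod 3), where F_1 and F_2 are the rows of F. -/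
open Finset

theorem ZMod.val_sum_le {ι : Type*} {n : ℕ} [NeZero n] (s : Finset ι) (x : ι → ZMod n) :
    (∑ i ∈ s, x i).val ≤ ∑ i ∈ s, (x i).val :=
  Finset.le_sum_of_subadditive ZMod.val ZMod.val_zero.le ZMod.val_add_le s x

theorem val_mul_eq_indicator (c h : ZMod 3) (hh : h ≠ 0) :
    (c * h).val = (if c = h then 1 else 0) + 2 * (if c = 2 * h then 1 else 0) := by
  revert c h; decide

theorem val_neg_mul_eq_indicator (c h : ZMod 3) (hh : h ≠ 0) :
    (-(c * h)).val = 2 * (if c = h then 1 else 0) + (if c = 2 * h then 1 else 0) := by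
  revert c h; decide

theorem indicator_add_le_val_add (c d h k : ZMod 3) (hh : h ≠ 0) (hk : k ≠ 0) :
    (if c = h then 1 else 0) + (if d = k then 1 else 0) ≤
      (c * h + d * k).val + (if c = 2 * h then 1 else 0) + (if d = 2 * k then 1 else 0) := by
  revert c d h k; decide

section Word

variable {ι : Type*} [DecidableEq ι] {s : Finset ι} {c h : ι → ZMod 3}

/-- The first family of cone inequalities, for a single codeword. -/
theorem word_single_le (hh : ∀ i ∈ s, h i ≠ 0) (hc : ∑ i ∈ s, c i * h i = 0) {l : ι}
    (hl : l ∈ s) :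
    2 * (if c l = h l then 1 else 0) + (if c l = 2 * h l then 1 else 0) ≤
      2 * ∑ i ∈ s.erase l, (if c i = 2 * h i then 1 else 0)
        + ∑ i ∈ s.erase l, (if c i = h i then 1 else 0) := by
  rw [← add_sum_erase s _ hl] at hc
  have hle := ZMod.val_sum_le (s.erase l) fun i => c i * h i
  rw [← neg_eq_of_add_eq_zero_right hc, val_neg_mul_eq_indicator _ _ (hh l hl),
    sum_congr rfl fun i hi => val_mul_eq_indicator (c i) (h i) (hh i (mem_of_mem_erase hi)),
    sum_add_distrib, ← mul_sum] at hle
  omega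

/-- The second family of cone inequalities, for a single codeword. -/
theorem word_pair_le (hh : ∀ i ∈ s, h i ≠ 0) (hc : ∑ i ∈ s, c i * h i = 0) {k l : ι}
    (hk : k ∈ s) (hl : l ∈ s) (hkl : k ≠ l) :
    (if c k = h k then 1 else 0) + (if c l = h l then 1 else 0) ≤
      2 * ∑ i ∈ (s.erase k).erase l, (if c i = h i then 1 else 0)
        + ∑ i ∈ s, (if c i = 2 * h i then 1 else 0) := by
  have hl' : l ∈ s.erase k := mem_erase.2 ⟨hkl.symm, hl⟩
  rw [← add_sum_erase s _ hk, ← add_sum_erase _ _ hl', ← add_assoc] at hc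
  rw [← add_sum_erase s (fun i => if c i = 2 * h i then 1 else 0) hk,
    ← add_sum_erase _ (fun i => if c i = 2 * h i then 1 else 0) hl']
  have hle := ZMod.val_sum_le ((s.erase k).erase l) fun i => -(c i * h i)
  rw [sum_neg_distrib, ← eq_neg_of_add_eq_zero_left hc,
    sum_congr rfl fun i hi => val_neg_mul_eq_indicator (c i) (h i)
      (hh i (mem_of_mem_erase (mem_of_mem_erase hi))),
    sum_add_distrib, ← mul_sum] at hle
  have := indicator_add_le_val_add (c k) (c l) (h k) (h l) (hh k hk) (hh l hl)
  omega

end Word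

section Count

variable {ι κ : Type*} [DecidableEq ι] [Fintype κ] {s : Finset ι} {c : κ → ι → ZMod 3}
  {h : ι → ZMod 3}

theorem count_single_le (hh : ∀ i ∈ s, h i ≠ 0) (hc : ∀ μ, ∑ i ∈ s, c μ i * h i = 0) {l : ι}
    (hl : l ∈ s) :
    2 * #{μ | c μ l = h l} + #{μ | c μ l = 2 * h l} ≤
      2 * ∑ i ∈ s.erase l, #{μ | c μ i = 2 * h i} + ∑ i ∈ s.erase l, #{μ | c μ i = h i} := by
  have := sum_le_sum fun μ (_ : μ ∈ univ) => word_single_le hh (hc μ) hl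
  simp only [sum_add_distrib, ← mul_sum] at this
  rw [sum_comm, sum_comm (t := s.erase l) (f := fun μ i => if c μ i = h i then 1 else 0)] at this
  simpa only [card_filter] using this

theorem count_pair_le (hh : ∀ i ∈ s, h i ≠ 0) (hc : ∀ μ, ∑ i ∈ s, c μ i * h i = 0) {k l : ι}
    (hk : k ∈ s) (hl : l ∈ s) (hkl : k ≠ l) :
    #{μ | c μ k = h k} + #{μ | c μ l = h l} ≤
      2 * ∑ i ∈ (s.erase k).erase l, #{μ | c μ i = h i} + ∑ i ∈ s, #{μ | c μ i = 2 * h i} := by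
  have := sum_le_sum fun μ (_ : μ ∈ univ) => word_pair_le hh (hc μ) hk hl hkl
  simp only [sum_add_distrib, ← mul_sum] at this
  rw [sum_comm, sum_comm (t := s) (f := fun μ i => if c μ i = 2 * h i then 1 else 0)] at this
  simpa only [card_filter] using this

end Count

theorem entryR_eq_card {n M : ℕ} {F : Matrix (Fin 2) (Fin n) ℕ} {c : Fin M → Fin n → ZMod 3}
    (h1 : ∀ i, F 0 i = #{μ | c μ i = 1}) (h2 : ∀ i, F 1 i = #{μ | c μ i = 2})
    {α : ZMod 3} (hα : α ≠ 0) (i : Fin n) :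
    entryR (F.map fun x => (x : ℝ)) α i = (#{μ | c μ i = α} : ℕ) := by
  obtain rfl | rfl : α = 1 ∨ α = 2 := by revert α; decide
  · simp [entryR, h1]
  · simp [entryR, h2, show (2 : ZMod 3) ≠ 1 by decide]

theorem mod3Cond_of_realizable {n : ℕ} {H : Matrix (Fin 1) (Fin n) (ZMod 3)}
    {F : Matrix (Fin 2) (Fin n) ℕ} (hreal : Realizable3 (H 0) F) : mod3Cond H F := by
  obtain ⟨M, c, hc, h1, h2⟩ := hreal
  intro j
  obtain rfl := Subsingleton.elim 0 j
  apply Int.emod_eq_zero_of_dvd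
  have hdvd := ZMod.intCast_zmod_eq_zero_iff_dvd
    (∑ i, ((H 0 i).val : ℤ) * ((F 0 i : ℤ) + 2 * (F 1 i : ℤ))) 3
  refine hdvd.1 ?_
  have hsymbol : ∀ a : ZMod 3, (if a = 1 then 1 else 0) + 2 * (if a = 2 then 1 else 0) = a := by
    decide
  have hcol : ∀ i, ((F 0 i : ZMod 3) + 2 * (F 1 i : ZMod 3)) = ∑ μ, c μ i := fun i => by
    rw [h1, h2, card_filter, card_filter]
    push_cast
    rw [mul_sum, ← sum_add_distrib]
    exact sum_congr rfl fun μ _ => hsymbol _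
  push_cast
  simp only [ZMod.natCast_val, ZMod.cast_id', id, hcol, mul_sum]
  rw [sum_comm]
  exact sum_eq_zero fun μ _ => by simpa only [mul_comm] using hc μ

/-- If a nonnegative integer matrix `F` is realizable over the single
parity-check code `C_j` checked by the 1×n matrix `H_j`, then `F ∈ K_3(H_j)`
and `H_j·(F_1^T + 2 F_2^T) ≡ 0 (mod 3)`. -/
theorem realizable_mem_ternaryCone {n : ℕ} (H : Matrix (Fin 1) (Fin n) (ZMod 3))
    (F : Matrix (Fin 2) (Fin n) ℕ)
    (hreal : Realizable3 (H 0) F) :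
    F.map (fun x => (x : ℝ)) ∈ ternaryCone H ∧ mod3Cond H F := by
  refine ⟨?_, mod3Cond_of_realizable hreal⟩
  obtain ⟨M, c, hc, h1, h2⟩ := hreal
  have hH : ∀ i ∈ suppRow H 0, H 0 i ≠ 0 := fun i hi => (mem_filter.1 hi).2
  have hH2 : ∀ i ∈ suppRow H 0, 2 * H 0 i ≠ 0 := fun i hi => by
    have : ∀ a : ZMod 3, a ≠ 0 → 2 * a ≠ 0 := by decide
    exact this _ (hH i hi)
  have hc1 : ∀ μ, ∑ i ∈ suppRow H 0, c μ i * H 0 i = 0 := fun μ => by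
    rw [← hc μ]
    exact sum_filter_of_ne fun i _ hi => right_ne_zero_of_mul hi
  have hc2 : ∀ μ, ∑ i ∈ suppRow H 0, c μ i * (2 * H 0 i) = 0 := fun μ => by
    simp only [mul_left_comm _ (2 : ZMod 3), ← mul_sum, hc1, mul_zero]
  have h4 : ∀ a : ZMod 3, 2 * (2 * a) = a := by decide
  have e1 : ∀ i ∈ suppRow H 0, entryR (F.map fun x => (x : ℝ)) (H 0 i) i =
      (#{μ | c μ i = H 0 i} : ℕ) := fun i hi => entryR_eq_card h1 h2 (hH i hi) i
  have e2 : ∀ i ∈ suppRow H 0, entryR (F.map fun x => (x : ℝ)) (2 * H 0 i) i =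
      (#{μ | c μ i = 2 * H 0 i} : ℕ) := fun i hi => entryR_eq_card h1 h2 (hH2 i hi) i
  have sub1 : ∀ l, (suppRow H 0).erase l ⊆ suppRow H 0 := fun l => erase_subset _ _
  have sub2 : ∀ k l, ((suppRow H 0).erase k).erase l ⊆ suppRow H 0 := fun k l =>
    (erase_subset _ _).trans (sub1 k)
  refine ⟨fun j l hl => ?_, fun j l hl => ?_, fun j k hk l hl hkl => ?_,
    fun j k hk l hl hkl => ?_, fun α i => by simp⟩ <;>
    obtain rfl := Subsingleton.elim 0 j
  · rw [e1 l hl, e2 l hl, sum_congr rfl fun i hi => e1 i (sub1 l hi),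
      sum_congr rfl fun i hi => e2 i (sub1 l hi)]
    exact_mod_cast count_single_le hH hc1 hl
  · rw [e1 l hl, e2 l hl, sum_congr rfl fun i hi => e1 i (sub1 l hi),
      sum_congr rfl fun i hi => e2 i (sub1 l hi)]
    have := count_single_le hH2 hc2 hl
    simp only [h4] at this
    exact_mod_cast this
  · rw [e1 k hk, e1 l hl, sum_congr rfl fun i hi => e1 i (sub2 k l hi), sum_congr rfl e2]
    exact_mod_cast count_pair_le hH hc1 hk hl hkl
  · rw [e2 k hk, e2 l hl, sum_congr rfl fun i hi => e2 i (sub2 k l hi), sum_congr rfl e1]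
    have := count_pair_le hH2 hc2 hk hl hkl
    simp only [h4] at this
    exact_mod_cast this
end
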